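/- arXiv:0903.3978 — 3 statements merged into one kernel-verified Lean document; each statement's English description precedes it below -/
import Mathlib

section
/- The universal theory of the class of torsion groups is strictly contained in the universal theory of the class of finite groups. That is: (i) every universal sentence in the language of groups that holds in all torsion groups holds in all finite groups, and (ii) there exists a universal sentence in the language of groups that holds in every finite group but fails in some torsion group. -/
open FirstOrder

/-- The first-order language of groups: one binary function symbol (multiplication),
one unary function symbol (inversion), and one constant symbol (identity). -/
def grpLang : FirstOrder.Language where
  Functions := fun n =>
    match n with
    | 0 => Unit
    | 1 => Unit
    | 2 => Unit
    | _ + 3 => Empty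
  Relations := fun _ => Empty

/-- Every group is naturally a structure for the language of groups. -/
instance grpStructure (G : Type*) [Group G] : grpLang.Structure G where
  funMap := fun {n} f x =>
    match n, f, x with
    | 0, _, _ => (1 : G)
    | 1, _, x => (x 0)⁻¹
    | 2, _, x => x 0 * x 1
    | _ + 3, f, _ => f.elim
  RelMap := fun {_} r _ => r.elim

/-- A universal sentence is one of the form `∀ x₁ … ∀ xₖ, Φ` with `Φ` quantifier-free. -/
def IsUniversalSentence (φ : grpLang.Sentence) : Prop :=
  ∃ (k : ℕ) (ψ : grpLang.BoundedFormula Empty k), ψ.IsQF ∧ φ = ψ.alls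

/-- The universal theory of a class of groups: the set of universal sentences that hold
in every group of the class. -/
def UnivTheoryOf (C : (G : Type) → Group G → Prop) : Set grpLang.Sentence :=
  {φ | IsUniversalSentence φ ∧ ∀ (G : Type) [inst : Group G], C G inst → G ⊨ φ}

namespace TorsionFinite

/-! ### The Grigorchuk group acting on the natural numbers through binary digits -/

/-- Flip the lowest binary digit. -/
def flipFun (n : ℕ) : ℕ := if n % 2 = 0 then n + 1 else n - 1

theorem flipFun_flipFun (n : ℕ) : flipFun (flipFun n) = n := by
  unfold flipFun; split_ifs <;> omega

/-- The rooted generator. -/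
def gA : Equiv.Perm ℕ := ⟨flipFun, flipFun, flipFun_flipFun, flipFun_flipFun⟩

theorem gA_even (m : ℕ) : gA (2 * m) = 2 * m + 1 := by
  change flipFun _ = _; unfold flipFun; split_ifs <;> omega

theorem gA_odd (m : ℕ) : gA (2 * m + 1) = 2 * m := by
  change flipFun _ = _; unfold flipFun; split_ifs <;> omega

theorem gA_mul_self : gA * gA = 1 := by
  ext n; exact flipFun_flipFun n

/-- The permutation acting below an odd first digit. -/
def gL (i : Fin 3) : Equiv.Perm ℕ := if i = 2 then 1 else gA

theorem gL_mul_self (i : Fin 3) : gL i * gL i = 1 := by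
  unfold gL; split_ifs <;> simp [gA_mul_self]

theorem gL_comm (i j : Fin 3) : gL i * gL j = gL j * gL i := by
  unfold gL; split_ifs <;> simp

/-- The directed generators. -/
def dirFun (i : Fin 3) (n : ℕ) : ℕ :=
  if h : n = 0 then 0
  else if n % 2 = 0 then 2 * dirFun (i + 1) (n / 2) else 2 * gL i (n / 2) + 1
termination_by n
decreasing_by omega

theorem dirFun_even (i : Fin 3) (m : ℕ) : dirFun i (2 * m) = 2 * dirFun (i + 1) m := by
  rcases Nat.eq_zero_or_pos m with rfl | h
  · rw [dirFun, dirFun]; simp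
  · rw [dirFun, dif_neg (by omega), if_pos (by omega)]
    congr 2; omega

theorem dirFun_odd (i : Fin 3) (m : ℕ) : dirFun i (2 * m + 1) = 2 * gL i m + 1 := by
  rw [dirFun, dif_neg (by omega), if_neg (by omega)]
  congr 3; omega

theorem dirFun_zero (i : Fin 3) : dirFun i 0 = 0 := by
  rw [dirFun]; simp

theorem bin_induction {P : ℕ → Prop} (h0 : P 0) (he : ∀ m, P m → P (2 * m))
    (ho : ∀ m, P m → P (2 * m + 1)) (n : ℕ) : P n := by
  induction n using Nat.strong_induction_on with
  | _ n ih =>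
    rcases Nat.even_or_odd' n with ⟨m, rfl | rfl⟩
    · rcases Nat.eq_zero_or_pos m with rfl | h
      · exact h0
      · exact he m (ih m (by omega))
    · exact ho m (ih m (by omega))

theorem dirFun_dirFun (n : ℕ) : ∀ i, dirFun i (dirFun i n) = n := by
  induction n using bin_induction with
  | h0 => intro i; simp [dirFun_zero]
  | he m ih => intro i; simp [dirFun_even, ih]
  | ho m ih =>
    intro i
    rw [dirFun_odd, dirFun_odd, ← Equiv.Perm.mul_apply, gL_mul_self]; simp

/-- The directed generators as permutations. -/
def gU (i : Fin 3) : Equiv.Perm ℕ :=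
  ⟨dirFun i, dirFun i, fun n => dirFun_dirFun n i, fun n => dirFun_dirFun n i⟩

theorem gU_even (i : Fin 3) (m : ℕ) : gU i (2 * m) = 2 * gU (i + 1) m := dirFun_even i m
theorem gU_odd (i : Fin 3) (m : ℕ) : gU i (2 * m + 1) = 2 * gL i m + 1 := dirFun_odd i m
theorem gU_zero (i : Fin 3) : gU i 0 = 0 := dirFun_zero i
theorem gU_mul_self (i : Fin 3) : gU i * gU i = 1 := by
  ext n; exact dirFun_dirFun n i

theorem gU_comm_apply (n : ℕ) : ∀ i j, gU i (gU j n) = gU j (gU i n) := by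
  induction n using bin_induction with
  | h0 => intro i j; simp [gU_zero]
  | he m ih => intro i j; simp [gU_even, ih (i + 1) (j + 1)]
  | ho m ih =>
    intro i j
    rw [gU_odd, gU_odd, gU_odd, gU_odd, ← Equiv.Perm.mul_apply, gL_comm, Equiv.Perm.mul_apply]

theorem gU_comm (i j : Fin 3) : gU i * gU j = gU j * gU i := by
  ext n; exact gU_comm_apply n i j

/-- Letters: `none` is the rooted generator, `some i` are the directed generators. -/
def letter : Option (Fin 3) → Equiv.Perm ℕ
  | none => gA
  | some i => gU i

theorem letter_mul_self (x : Option (Fin 3)) : letter x * letter x = 1 := by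
  cases x with
  | none => exact gA_mul_self
  | some i => exact gU_mul_self i

/-- Evaluation of a word. -/
def ev (w : List (Option (Fin 3))) : Equiv.Perm ℕ := (w.map letter).prod

@[simp] theorem ev_nil : ev [] = 1 := rfl
@[simp] theorem ev_cons (x : Option (Fin 3)) (w : List (Option (Fin 3))) :
    ev (x :: w) = letter x * ev w := by simp [ev]
theorem ev_append (w w' : List (Option (Fin 3))) : ev (w ++ w') = ev w * ev w' := by
  simp [ev]
theorem ev_reverse (w : List (Option (Fin 3))) : ev w.reverse * ev w = 1 := by
  induction w with
  | nil => simp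
  | cons x w ih =>
    rw [List.reverse_cons, ev_append, ev_cons, ev_cons, ev_nil, mul_one, mul_assoc,
      ← mul_assoc (letter x), letter_mul_self, one_mul, ih]

/-- Whether the word flips the first digit. -/
def flips : List (Option (Fin 3)) → Bool
  | [] => false
  | none :: w => !(flips w)
  | some _ :: w => flips w

/-- The word describing the action below the first digit `s`. -/
def sec : List (Option (Fin 3)) → Bool → List (Option (Fin 3))
  | [], _ => []
  | none :: w, s => sec w s
  | some i :: w, s =>
    if (s ^^ flips w) then (if i = 2 then sec w s else none :: sec w s)
    else some (i + 1) :: sec w s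

theorem ev_apply (w : List (Option (Fin 3))) (s : Bool) (m : ℕ) :
    ev w (2 * m + s.toNat) = 2 * ev (sec w s) m + (s ^^ flips w).toNat := by
  induction w with
  | nil => simp [sec, flips]
  | cons x w ih =>
    rw [ev_cons, Equiv.Perm.mul_apply, ih]
    cases x with
    | none =>
      simp only [letter, sec, flips]
      cases h : (s ^^ flips w) <;> simp [h, gA_even, gA_odd]
    | some i =>
      simp only [letter, sec, flips]
      cases h : (s ^^ flips w)
      · simp [gU_even, letter]
      · by_cases hi : i = 2 <;> simp [gU_odd, gL, hi, letter]

/-- Number of directed letters. -/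
def wt (w : List (Option (Fin 3))) : ℕ := w.count (some 0) + w.count (some 1) + w.count (some 2)

theorem count_sec_some (w : List (Option (Fin 3))) (i : Fin 3) :
    (sec w false).count (some (i + 1)) + (sec w true).count (some (i + 1)) =
      w.count (some i) := by
  induction w with
  | nil => simp [sec]
  | cons x w ih =>
    cases x with
    | none => simpa [sec] using ih
    | some j =>
      simp only [sec]
      cases h : flips w <;> fin_cases i <;> fin_cases j <;>
        simp [List.count_cons] at ih ⊢ <;> omega

theorem count_sec_none (w : List (Option (Fin 3))) :
    (sec w false).count none + (sec w true).count none =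
      w.count (some 0) + w.count (some 1) := by
  induction w with
  | nil => simp [sec]
  | cons x w ih =>
    cases x with
    | none => simpa [sec] using ih
    | some j =>
      simp only [sec]
      cases h : flips w <;> fin_cases j <;>
        simp [List.count_cons] <;> omega

theorem wt_sec (w : List (Option (Fin 3))) : wt (sec w false) + wt (sec w true) = wt w := by
  have h0 := count_sec_some w 0
  have h1 := count_sec_some w 1
  have h2 := count_sec_some w 2
  have e : (2 : Fin 3) + 1 = 0 := rfl
  have e' : (1 : Fin 3) + 1 = 2 := rfl
  rw [e] at h2; rw [e'] at h1; rw [zero_add] at h0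
  unfold wt; omega

theorem flips_append (w w' : List (Option (Fin 3))) :
    flips (w ++ w') = (flips w ^^ flips w') := by
  induction w with
  | nil => simp [flips]
  | cons x w ih => cases x <;> simp [flips, ih]

theorem flips_eq (w : List (Option (Fin 3))) : flips w = decide (w.count none % 2 = 1) := by
  induction w with
  | nil => simp [flips]
  | cons x w ih =>
    cases x
    · simp only [flips, ih, List.count_cons]
      rcases Nat.mod_two_eq_zero_or_one (w.count none) with h | h <;>
        simp [h, Nat.add_mod]
    · simp [flips, ih]

theorem sec_append (w w' : List (Option (Fin 3))) (s : Bool) :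
    sec (w ++ w') s = sec w (s ^^ flips w') ++ sec w' s := by
  induction w with
  | nil => simp [sec]
  | cons x w ih =>
    cases x
    · simp [sec, ih]
    · simp only [List.cons_append, sec, ih, flips_append]
      cases s <;> cases flips w <;> cases flips w' <;> simp <;> split_ifs <;> simp

/-- If a word does not flip the first digit and its two sections are torsion, so is the word. -/
theorem torsion_of_sec (w : List (Option (Fin 3))) (hw : flips w = false)
    (h : ∀ s, IsOfFinOrder (ev (sec w s))) : IsOfFinOrder (ev w) := by
  have key : ∀ n s m, (ev w ^ n) (2 * m + s.toNat) = 2 * (ev (sec w s) ^ n) m + s.toNat := by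
    intro n s
    induction n with
    | zero => simp
    | succ n ih =>
      intro m
      rw [pow_succ, Equiv.Perm.mul_apply, ev_apply, hw, Bool.xor_false, ih, pow_succ,
        Equiv.Perm.mul_apply]
  obtain ⟨n0, hn0, h0⟩ := isOfFinOrder_iff_pow_eq_one.1 (h false)
  obtain ⟨n1, hn1, h1⟩ := isOfFinOrder_iff_pow_eq_one.1 (h true)
  refine isOfFinOrder_iff_pow_eq_one.2 ⟨n0 * n1, Nat.mul_pos hn0 hn1, ?_⟩
  ext n
  rcases Nat.even_or_odd' n with ⟨m, rfl | rfl⟩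
  · have := key (n0 * n1) false m
    rw [pow_mul, pow_mul, h0] at this
    simpa [pow_mul] using this
  · have := key (n0 * n1) true m
    rw [mul_comm, pow_mul, pow_mul, h1] at this
    rw [mul_comm, pow_mul]
    simpa using this

theorem klein (w : List (Option (Fin 3))) (s : Bool) (hs : wt (sec w (!s)) = 0) :
    ∃ v : Equiv.Perm ℕ, v * v = 1 ∧ (∀ i, gU i * v = v * gU i) ∧
      ev w = (if (s ^^ flips w) then gA else 1) * v * (if s then gA else 1) := by
  induction w with
  | nil =>
    refine ⟨1, by simp, by simp, ?_⟩
    cases s <;> simp [flips, gA_mul_self]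
  | cons x w ih =>
    cases x with
    | none =>
      obtain ⟨v, h1, h2, h3⟩ := ih (by simpa [sec] using hs)
      refine ⟨v, h1, h2, ?_⟩
      rw [ev_cons, h3]
      simp only [flips, letter]
      cases s <;> by_cases hfw : flips w = true <;> simp [hfw, ← mul_assoc, gA_mul_self]
    | some i =>
      simp only [sec] at hs
      have hb : (s ^^ flips w) = false := by
        by_contra hb
        have hb' : ((!s) ^^ flips w) = false := by
          revert hb; cases s <;> cases flips w <;> simp
        rw [hb'] at hs
        revert hs
        fin_cases i <;> simp [wt, List.count_cons]
      have hb' : ((!s) ^^ flips w) = true := by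
        revert hb; cases s <;> cases flips w <;> simp
      rw [hb', if_pos rfl] at hs
      obtain ⟨v, h1, h2, h3⟩ := ih (by
        split_ifs at hs
        · exact hs
        · simpa [wt] using hs)
      refine ⟨gU i * v, ?_, ?_, ?_⟩
      · rw [mul_assoc, ← mul_assoc v, ← h2, mul_assoc, h1, mul_one, gU_mul_self]
      · intro j
        rw [← mul_assoc, gU_comm, mul_assoc, h2, mul_assoc]
      · rw [ev_cons, h3]
        simp only [flips, letter, hb]
        simp [mul_assoc]

theorem torsion_ev : ∀ (k : ℕ) (w : List (Option (Fin 3))), wt w = k → IsOfFinOrder (ev w) := by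
  intro k
  induction k using Nat.strong_induction_on with
  | _ k ih =>
  -- words not flipping the first digit
  have T0 : ∀ w, wt w = k → flips w = false → IsOfFinOrder (ev w) := by
    intro w hk hw
    have hsum := wt_sec w
    by_cases hz : ∃ s, wt (sec w (!s)) = 0
    · obtain ⟨s, hs⟩ := hz
      obtain ⟨v, h1, -, h3⟩ := klein w s hs
      refine isOfFinOrder_iff_pow_eq_one.2 ⟨2, by norm_num, ?_⟩
      rw [h3, hw, pow_two]
      cases s
      · simp [h1]
      · simp only [Bool.xor_false, if_true]
        calc gA * v * gA * (gA * v * gA) = gA * v * (gA * gA) * v * gA := by group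
          _ = gA * (v * v) * gA := by rw [gA_mul_self]; group
          _ = 1 := by rw [h1, mul_one, gA_mul_self]
    · push Not at hz
      have ht := hz false
      have hf := hz true
      simp only [Bool.not_false, Bool.not_true] at ht hf
      refine torsion_of_sec w hw fun s => ?_
      cases s
      · exact ih _ (by omega) _ rfl
      · exact ih _ (by omega) _ rfl
  -- reduction for words flipping the first digit
  have step : ∀ w, flips w = true →
      (∀ w', (∀ i, w'.count (some (i + 1)) = w.count (some i)) →
        w'.count none = w.count (some 0) + w.count (some 1) → IsOfFinOrder (ev w')) →
      IsOfFinOrder (ev w) := by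
    intro w hw h
    have h2 : IsOfFinOrder (ev w ^ 2) := by
      rw [pow_two, ← ev_append]
      refine torsion_of_sec _ (by simp [flips_append, hw]) fun s => ?_
      rw [sec_append, hw]
      refine h _ (fun i => ?_) ?_
      · rw [List.count_append, ← count_sec_some w i]
        cases s <;> simp [add_comm]
      · rw [List.count_append, ← count_sec_none w]
        cases s <;> simp [add_comm]
    exact h2.of_pow (by norm_num)
  have cyc : ∀ w w' : List (Option (Fin 3)),
      (∀ i, w'.count (some (i + 1)) = w.count (some i)) →
      w'.count (some 1) = w.count (some 0) ∧ w'.count (some 2) = w.count (some 1) ∧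
        w'.count (some 0) = w.count (some 2) := fun w w' h => ⟨h 0, h 1, h 2⟩
  have T1 : ∀ w, wt w = k → flips w = true →
      (w.count (some 0) + w.count (some 1)) % 2 = 0 → IsOfFinOrder (ev w) := by
    intro w hk hw hp
    refine step w hw fun w' h1 h2 => ?_
    obtain ⟨a1, a2, a3⟩ := cyc w w' h1
    refine T0 w' ?_ ?_
    · unfold wt at *; omega
    · rw [flips_eq, h2]; simp [hp]
  have T2 : ∀ w, wt w = k → flips w = true →
      (w.count (some 2) + w.count (some 0)) % 2 = 0 → IsOfFinOrder (ev w) := by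
    intro w hk hw hp
    refine step w hw fun w' h1 h2 => ?_
    obtain ⟨a1, a2, a3⟩ := cyc w w' h1
    have hk' : wt w' = k := by unfold wt at *; omega
    cases hf : flips w'
    · exact T0 w' hk' hf
    · exact T1 w' hk' hf (by omega)
  have T3 : ∀ w, wt w = k → flips w = true →
      (w.count (some 1) + w.count (some 2)) % 2 = 0 → IsOfFinOrder (ev w) := by
    intro w hk hw hp
    refine step w hw fun w' h1 h2 => ?_
    obtain ⟨a1, a2, a3⟩ := cyc w w' h1
    have hk' : wt w' = k := by unfold wt at *; omega
    cases hf : flips w'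
    · exact T0 w' hk' hf
    · exact T2 w' hk' hf (by omega)
  intro w hk
  cases hf : flips w
  · exact T0 w hk hf
  · by_cases h1 : (w.count (some 0) + w.count (some 1)) % 2 = 0
    · exact T1 w hk hf h1
    · by_cases h2 : (w.count (some 2) + w.count (some 0)) % 2 = 0
      · exact T2 w hk hf h2
      · exact T3 w hk hf (by omega)

/-- The Grigorchuk group. -/
def Grig : Subgroup (Equiv.Perm ℕ) where
  carrier := {g | ∃ w, ev w = g}
  one_mem' := ⟨[], rfl⟩
  mul_mem' := by
    rintro _ _ ⟨w, rfl⟩ ⟨w', rfl⟩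
    exact ⟨w ++ w', ev_append w w'⟩
  inv_mem' := by
    rintro _ ⟨w, rfl⟩
    exact ⟨w.reverse, eq_inv_of_mul_eq_one_left (ev_reverse w)⟩

theorem grig_torsion (g : Grig) : IsOfFinOrder g := by
  obtain ⟨w, hw⟩ := g.2
  rw [← Submonoid.isOfFinOrder_coe, ← hw]
  exact torsion_ev _ w rfl

theorem letter_mem (x : Option (Fin 3)) : letter x ∈ Grig := ⟨[x], by simp⟩

/-! ### A piecewise injective, non-surjective map -/

/-- Parity of the number of ones in the binary expansion. -/
def pc (n : ℕ) : Bool :=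
  if h : n = 0 then false else (pc (n / 2) ^^ decide (n % 2 = 1))
termination_by n
decreasing_by omega

theorem pc_zero : pc 0 = false := by rw [pc]; simp

theorem pc_even (m : ℕ) : pc (2 * m) = pc m := by
  rcases Nat.eq_zero_or_pos m with rfl | h
  · rfl
  · rw [pc, dif_neg (by omega)]
    have h1 : 2 * m / 2 = m := by omega
    have h2 : 2 * m % 2 = 0 := by omega
    rw [h1, h2]; simp

theorem pc_odd (m : ℕ) : pc (2 * m + 1) = !(pc m) := by
  rw [pc, dif_neg (by omega)]
  have h1 : (2 * m + 1) / 2 = m := by omega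
  have h2 : (2 * m + 1) % 2 = 1 := by omega
  rw [h1, h2]; simp

theorem pc_gA (n : ℕ) : pc (gA n) = !(pc n) := by
  rcases Nat.even_or_odd' n with ⟨m, rfl | rfl⟩
  · rw [gA_even, pc_odd, pc_even]
  · rw [gA_odd, pc_odd, pc_even, Bool.not_not]

theorem pc_gU (n : ℕ) : ∀ i, gU i n ≠ n → pc (gU i n) = !(pc n) := by
  induction n using bin_induction with
  | h0 => intro i h; exact absurd (gU_zero i) h
  | he m ih =>
    intro i h
    rw [gU_even] at h ⊢
    rw [pc_even, pc_even]
    exact ih _ (fun h' => h (by rw [h']))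
  | ho m ih =>
    intro i h
    rw [gU_odd] at h ⊢
    rw [pc_odd, pc_odd]
    unfold gL at h ⊢
    split_ifs at h ⊢
    · simp at h
    · rw [pc_gA]

theorem moved (n : ℕ) : ∀ i, n ≠ 0 → gU i n = n → gU (i + 1) n ≠ n := by
  induction n using bin_induction with
  | h0 => intro i h; exact absurd rfl h
  | he m ih =>
    intro i h
    rw [gU_even, gU_even]
    intro h1 h2
    exact ih (i + 1) (by omega) (by omega) (by omega)
  | ho m ih =>
    intro i _
    rw [gU_odd, gU_odd]
    have ha : gA m ≠ m := fun h => by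
      have := pc_gA m
      rw [h] at this
      cases hp : pc m <;> simp [hp] at this
    fin_cases i <;> simp [gL, ha]

/-- The three moves. -/
def mv : Fin 3 → Equiv.Perm ℕ := ![gA, gU 0, gU 1]

/-- The three pieces. -/
def pieceP : Fin 3 → ℕ → Prop :=
  ![fun n => pc n = false, fun n => pc n = true ∧ gU 0 n ≠ n, fun n => pc n = true ∧ gU 0 n = n]

theorem mv_mem (i : Fin 3) : mv i ∈ Grig := by
  fin_cases i
  · exact letter_mem none
  · exact letter_mem (some 0)
  · exact letter_mem (some 1)

theorem mv_mv (i : Fin 3) (n : ℕ) : mv i (mv i n) = n := by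
  rw [← Equiv.Perm.mul_apply]
  fin_cases i
  · exact congrArg (fun g : Equiv.Perm ℕ => g n) gA_mul_self
  · exact congrArg (fun g : Equiv.Perm ℕ => g n) (gU_mul_self 0)
  · exact congrArg (fun g : Equiv.Perm ℕ => g n) (gU_mul_self 1)

theorem piece_cover (n : ℕ) : ∃ i, pieceP i n := by
  cases h : pc n
  · exact ⟨0, h⟩
  · by_cases h' : gU 0 n = n
    · exact ⟨2, h, h'⟩
    · exact ⟨1, h, h'⟩

theorem piece_unique (n : ℕ) (i j : Fin 3) (hi : pieceP i n) (hj : pieceP j n) : i = j := by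
  fin_cases i <;> fin_cases j <;> simp [pieceP] at hi hj ⊢ <;> simp_all

/-- The invariant separating the images of the pieces. -/
theorem image_char (n : ℕ) (i : Fin 3) (hi : pieceP i (mv i n)) :
    (i = 0 ∧ pc n = true) ∨ (i = 1 ∧ pc n = false ∧ gU 0 n ≠ n) ∨
      (i = 2 ∧ pc n = false ∧ gU 0 n = n ∧ n ≠ 0) := by
  fin_cases i
  · left
    simpa [pieceP, mv, pc_gA] using hi
  · right; left
    have h : pc (gU 0 n) = true ∧ gU 0 (gU 0 n) ≠ gU 0 n := hi
    have h1 : gU 0 n ≠ n := fun h' => h.2 (by rw [h', h'])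
    have := pc_gU n 0 h1
    refine ⟨rfl, ?_, h1⟩
    rw [h.1] at this
    simpa using this.symm
  · right; right
    have h : pc (gU 1 n) = true ∧ gU 0 (gU 1 n) = gU 1 n := hi
    have h1 : gU 0 n = n := (gU 1).injective (by rw [← gU_comm_apply]; exact h.2)
    have h0 : n ≠ 0 := by
      rintro rfl
      have := h.1
      rw [gU_zero, pc_zero] at this
      simp at this
    have := pc_gU n 1 (moved n 0 h0 h1)
    rw [h.1] at this
    exact ⟨rfl, by simpa using this.symm, h1, h0⟩

theorem image_unique (n : ℕ) (i j : Fin 3) (hi : pieceP i (mv i n)) (hj : pieceP j (mv j n)) :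
    i = j := by
  have h1 := image_char n i hi
  have h2 := image_char n j hj
  rcases h1 with ⟨rfl, h1⟩ | ⟨rfl, h1⟩ | ⟨rfl, h1⟩ <;>
    rcases h2 with ⟨rfl, h2⟩ | ⟨rfl, h2⟩ | ⟨rfl, h2⟩ <;> simp_all

theorem image_zero (i : Fin 3) : ¬ pieceP i (mv i 0) := by
  intro h
  rcases image_char 0 i h with ⟨-, h⟩ | ⟨-, -, h⟩ | ⟨-, -, -, h⟩
  · rw [pc_zero] at h; simp at h
  · exact h (gU_zero 0)
  · exact h rfl

/-! ### The finite-group lemma -/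

section Ops

variable {α : Type*} [Mul α] [Inv α]

/-- Commutator-type expression. -/
def cE (g z : α) : α := g * z * g⁻¹ * z⁻¹

/-- The word for the first operator. -/
def opX (e : Fin 6 → α) (z : α) : α :=
  (e 0 * cE (e 3) z * (e 0)⁻¹) * (e 1 * cE (e 4) z * (e 1)⁻¹) * (e 2 * cE (e 5) z * (e 2)⁻¹)

/-- The word for the second operator. -/
def opY (e : Fin 6 → α) (z : α) : α :=
  cE (e 3) ((e 0)⁻¹ * z * e 0) * cE (e 4) ((e 1)⁻¹ * z * e 1) * cE (e 5) ((e 2)⁻¹ * z * e 2)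

/-- The word `[p, q]`. -/
def mW (p q : α) : α := p * q * p⁻¹ * q⁻¹

end Ops

theorem opX_conj {G : Type*} [Group G] (e : Fin 6 → G) (f z : G)
    (h : ∀ i, f * e i * f⁻¹ = e i) : opX e (f * z * f⁻¹) = f * opX e z * f⁻¹ := by
  have : ∀ z, MulAut.conj f (opX e z) = opX (fun i => MulAut.conj f (e i)) (MulAut.conj f z) := by
    intro z; simp only [opX, cE, map_mul, map_inv]
  have h2 := this z
  simp only [MulAut.conj_apply, h] at h2
  exact h2.symm

theorem opY_conj {G : Type*} [Group G] (e : Fin 6 → G) (f z : G)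
    (h : ∀ i, f * e i * f⁻¹ = e i) : opY e (f * z * f⁻¹) = f * opY e z * f⁻¹ := by
  have : ∀ z, MulAut.conj f (opY e z) = opY (fun i => MulAut.conj f (e i)) (MulAut.conj f z) := by
    intro z; simp only [opY, cE, map_mul, map_inv]
  have h2 := this z
  simp only [MulAut.conj_apply, h] at h2
  exact h2.symm

/-- The abstract finiteness argument on an abelian finite subgroup. -/
theorem finite_core {G : Type*} [Group G] [Finite G] (S : Set G) (e : Fin 6 → G)
    (hS : ∀ a ∈ S, ∀ b ∈ S, a * b = b * a)
    (h1 : ∀ i, ∀ a ∈ S, e i * a * (e i)⁻¹ ∈ S)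
    (h2 : ∀ i, ∀ a ∈ S, (e i)⁻¹ * a * e i ∈ S)
    (hYX : ∀ a ∈ S, opY e (opX e a) = a) : ∀ a ∈ S, opX e (opY e a) = a := by
  letI : CommGroup (Subgroup.closure S) := Subgroup.closureCommGroupOfComm hS
  have cmem : ∀ g : G, (∀ a ∈ S, g * a * g⁻¹ ∈ S) → ∀ a ∈ Subgroup.closure S,
      g * a * g⁻¹ ∈ Subgroup.closure S := by
    intro g hg a ha
    induction ha using Subgroup.closure_induction with
    | mem x hx => exact Subgroup.subset_closure (hg x hx)
    | one => simp
    | mul x y _ _ hx hy =>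
      have := mul_mem hx hy
      have e : g * x * g⁻¹ * (g * y * g⁻¹) = g * (x * y) * g⁻¹ := by group
      rwa [e] at this
    | inv x _ hx =>
      have := inv_mem hx
      have e : (g * x * g⁻¹)⁻¹ = g * x⁻¹ * g⁻¹ := by group
      rwa [e] at this
  let c : Fin 6 → Subgroup.closure S →* Subgroup.closure S := fun i =>
    { toFun := fun a => ⟨e i * a * (e i)⁻¹, cmem _ (h1 i) a a.2⟩
      map_one' := by ext; simp
      map_mul' := fun x y => by
        ext
        change e i * ((x : G) * (y : G)) * (e i)⁻¹ = (e i * x * (e i)⁻¹) * (e i * y * (e i)⁻¹)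
        group }
  let d : Fin 6 → Subgroup.closure S →* Subgroup.closure S := fun i =>
    { toFun := fun a => ⟨(e i)⁻¹ * a * e i, by
        have := cmem (e i)⁻¹ (by simpa using h2 i) a a.2
        simpa using this⟩
      map_one' := by ext; simp
      map_mul' := fun x y => by
        ext
        change (e i)⁻¹ * ((x : G) * (y : G)) * e i = ((e i)⁻¹ * x * e i) * ((e i)⁻¹ * y * e i)
        group }
  let E : Fin 6 → Subgroup.closure S →* Subgroup.closure S := fun i =>
    c i * (MonoidHom.id _)⁻¹
  let XH : Subgroup.closure S →* Subgroup.closure S :=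
    (c 0).comp (E 3) * (c 1).comp (E 4) * (c 2).comp (E 5)
  let YH : Subgroup.closure S →* Subgroup.closure S :=
    (E 3).comp (d 0) * (E 4).comp (d 1) * (E 5).comp (d 2)
  have hX : ∀ a, ((XH a : Subgroup.closure S) : G) = opX e a := fun a => rfl
  have hY : ∀ a, ((YH a : Subgroup.closure S) : G) = opY e a := fun a => rfl
  have hid : ∀ a : Subgroup.closure S, YH (XH a) = a := by
    rintro ⟨a, ha⟩
    induction ha using Subgroup.closure_induction with
    | mem x hx => ext; rw [hY, hX]; exact hYX x hx
    | one =>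
      change YH (XH 1) = 1
      simp
    | mul x y hx hy ihx ihy =>
      change YH (XH (⟨x, hx⟩ * ⟨y, hy⟩)) = ⟨x, hx⟩ * ⟨y, hy⟩
      rw [map_mul, map_mul, ihx, ihy]
    | inv x hx ihx =>
      change YH (XH (⟨x, hx⟩)⁻¹) = (⟨x, hx⟩)⁻¹
      rw [map_inv, map_inv, ihx]
  have hinj : Function.Injective XH := Function.LeftInverse.injective hid
  have hsurj : Function.Surjective XH := Finite.surjective_of_injective hinj
  intro a ha
  obtain ⟨b, hb⟩ := hsurj ⟨a, Subgroup.subset_closure ha⟩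
  have h3 : XH (YH ⟨a, Subgroup.subset_closure ha⟩) = ⟨a, Subgroup.subset_closure ha⟩ := by
    rw [← hb, hid]
  have h4 := congrArg (Subtype.val) h3
  rwa [hX, hY] at h4

theorem finite_lemma {G : Type*} [Group G] [Finite G] (p q : G) (e f : Fin 6 → G)
    (hfp : ∀ i, f i * p = p * f i) (heq : ∀ i, e i * q = q * e i)
    (hmp : mW p q * p = p * mW p q) (hmq : mW p q * q = q * mW p q)
    (hef : ∀ i j, e i * f j = f j * e i)
    (hem : ∀ i, e i * mW p q * (e i)⁻¹ = (f i)⁻¹ * mW p q * f i)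
    (hYX : opY e (opX e (mW p q)) = mW p q) : opX e (opY e (mW p q)) = mW p q := by
  have hm : mW p q = p * q * p⁻¹ * q⁻¹ := rfl
  generalize mW p q = m at *
  have hFE : ∀ x ∈ Subgroup.closure (Set.range f), ∀ y ∈ Subgroup.closure (Set.range e),
      Commute x y := by
    intro x hx y hy
    induction hx using Subgroup.closure_induction with
    | mem x hx =>
      obtain ⟨j, rfl⟩ := hx
      induction hy using Subgroup.closure_induction with
      | mem y hy => obtain ⟨i, rfl⟩ := hy; exact (hef i j).symm
      | one => exact Commute.one_right _
      | mul _ _ _ _ h1 h2 => exact h1.mul_right h2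
      | inv _ _ h => exact h.inv_right
    | one => exact Commute.one_left _
    | mul _ _ _ _ h1 h2 => exact h1.mul_left h2
    | inv _ _ h => exact h.inv_left
  have hei : ∀ i, e i ∈ Subgroup.closure (Set.range e) := fun i =>
    Subgroup.subset_closure ⟨i, rfl⟩
  have hfi : ∀ i, f i ∈ Subgroup.closure (Set.range f) := fun i =>
    Subgroup.subset_closure ⟨i, rfl⟩
  have hFp : ∀ x ∈ Subgroup.closure (Set.range f), Commute x p := by
    intro x hx
    induction hx using Subgroup.closure_induction with
    | mem x hx => obtain ⟨j, rfl⟩ := hx; exact hfp j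
    | one => exact Commute.one_left _
    | mul _ _ _ _ h1 h2 => exact h1.mul_left h2
    | inv _ _ h => exact h.inv_left
  have hEq : ∀ x ∈ Subgroup.closure (Set.range e), Commute x q := by
    intro x hx
    induction hx using Subgroup.closure_induction with
    | mem x hx => obtain ⟨j, rfl⟩ := hx; exact heq j
    | one => exact Commute.one_left _
    | mul _ _ _ _ h1 h2 => exact h1.mul_left h2
    | inv _ _ h => exact h.inv_left
  have hem' : ∀ i, (e i)⁻¹ * m * e i = f i * m * (f i)⁻¹ := by
    intro i
    have h := hem i
    have c : Commute (e i) (f i) := hef i i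
    have h5 : m = (e i)⁻¹ * ((f i)⁻¹ * m * f i) * e i := by rw [← h]; group
    calc (e i)⁻¹ * m * e i
        = f i * ((f i)⁻¹ * (e i)⁻¹) * m * (e i * f i) * (f i)⁻¹ := by group
      _ = f i * ((e i)⁻¹ * (f i)⁻¹) * m * (f i * e i) * (f i)⁻¹ := by
          rw [c.eq, c.inv_inv.eq]
      _ = f i * ((e i)⁻¹ * ((f i)⁻¹ * m * f i) * e i) * (f i)⁻¹ := by group
      _ = _ := by rw [← h5]
  have hconj : ∀ x ∈ Subgroup.closure (Set.range f), ∃ y ∈ Subgroup.closure (Set.range e),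
      x * m * x⁻¹ = y * m * y⁻¹ := by
    intro x hx
    induction hx using Subgroup.closure_induction with
    | mem x hx =>
      obtain ⟨j, rfl⟩ := hx
      exact ⟨(e j)⁻¹, inv_mem (hei j), by rw [inv_inv, hem']⟩
    | one => exact ⟨1, one_mem _, rfl⟩
    | mul x x' hx hx' h1 h2 =>
      obtain ⟨y, hy, h1⟩ := h1
      obtain ⟨y', hy', h2⟩ := h2
      refine ⟨y' * y, mul_mem hy' hy, ?_⟩
      have c := hFE x hx y' hy'
      calc x * x' * m * (x * x')⁻¹ = x * (x' * m * x'⁻¹) * x⁻¹ := by group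
        _ = (x * y') * m * (y'⁻¹ * x⁻¹) := by rw [h2]; group
        _ = (y' * x) * m * (x⁻¹ * y'⁻¹) := by rw [c.eq, c.inv_inv.eq]
        _ = y' * (x * m * x⁻¹) * y'⁻¹ := by group
        _ = _ := by rw [h1]; group
    | inv x hx h1 =>
      obtain ⟨y, hy, h1⟩ := h1
      refine ⟨y⁻¹, inv_mem hy, ?_⟩
      have c := hFE x hx y hy
      calc x⁻¹ * m * x⁻¹⁻¹ = x⁻¹ * y⁻¹ * (y * m * y⁻¹) * (y * x) := by group
        _ = y⁻¹ * x⁻¹ * (x * m * x⁻¹) * (x * y) := by rw [← h1, c.eq, c.inv_inv.eq]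
        _ = _ := by group
  have hSp : ∀ x ∈ Subgroup.closure (Set.range f), Commute (x * m * x⁻¹) p := fun x hx =>
    ((hFp x hx).mul_left hmp).mul_left (hFp x hx).inv_left
  have hSq : ∀ x ∈ Subgroup.closure (Set.range f), Commute (x * m * x⁻¹) q := by
    intro x hx
    obtain ⟨y, hy, h⟩ := hconj x hx
    rw [h]
    exact ((hEq y hy).mul_left hmq).mul_left (hEq y hy).inv_left
  have hSm : ∀ x ∈ Subgroup.closure (Set.range f), Commute (x * m * x⁻¹) m := by
    intro x hx
    have h1 := hSp x hx
    have h2 := hSq x hx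
    have := ((h1.mul_right h2).mul_right h1.inv_right).mul_right h2.inv_right
    rwa [← hm] at this
  have hfix : ∀ x ∈ Subgroup.closure (Set.range f), ∀ i, x * e i * x⁻¹ = e i := by
    intro x hx i
    rw [(hFE x hx (e i) (hei i)).eq]; group
  have main := finite_core {z | ∃ x ∈ Subgroup.closure (Set.range f), z = x * m * x⁻¹} e
    (by
      rintro _ ⟨x, hx, rfl⟩ _ ⟨y, hy, rfl⟩
      have h := (hSm (y⁻¹ * x) (mul_mem (inv_mem hy) hx)).eq
      calc x * m * x⁻¹ * (y * m * y⁻¹)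
          = y * ((y⁻¹ * x * m * (y⁻¹ * x)⁻¹) * m) * y⁻¹ := by group
        _ = _ := by rw [h]; group)
    (by
      rintro i _ ⟨x, hx, rfl⟩
      refine ⟨x * (f i)⁻¹, mul_mem hx (inv_mem (hfi i)), ?_⟩
      have c := hFE x hx (e i) (hei i)
      calc e i * (x * m * x⁻¹) * (e i)⁻¹ = (e i * x) * m * (x⁻¹ * (e i)⁻¹) := by group
        _ = (x * e i) * m * ((e i)⁻¹ * x⁻¹) := by rw [c.eq, c.inv_inv.eq]
        _ = x * (e i * m * (e i)⁻¹) * x⁻¹ := by group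
        _ = _ := by rw [hem]; group)
    (by
      rintro i _ ⟨x, hx, rfl⟩
      refine ⟨x * f i, mul_mem hx (hfi i), ?_⟩
      have c := (hFE x hx (e i) (hei i)).inv_right
      have c' := (hFE x hx (e i) (hei i)).inv_left
      calc (e i)⁻¹ * (x * m * x⁻¹) * e i = ((e i)⁻¹ * x) * m * (x⁻¹ * e i) := by group
        _ = (x * (e i)⁻¹) * m * (e i * x⁻¹) := by rw [c.eq, c'.eq]
        _ = x * ((e i)⁻¹ * m * e i) * x⁻¹ := by group
        _ = _ := by rw [hem']; group)
    (by
      rintro _ ⟨x, hx, rfl⟩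
      rw [opX_conj e x m (hfix x hx), opY_conj e x _ (hfix x hx), hYX])
  exact main m ⟨1, one_mem _, by simp⟩

/-! ### The torsion group of triangular matrices -/

section HTsec

variable {R : Type} [Ring R]

/-- Upper triangular matrices `[[e, u, w], [0, 1, v], [0, 0, f]]`. -/
@[ext]
structure HT (Γ : Subgroup Rˣ) where
  /-- upper left entry -/
  e : Γ
  /-- lower right entry -/
  f : Γ
  /-- entry (1,2) -/
  u : R
  /-- entry (2,3) -/
  v : R
  /-- entry (1,3) -/
  w : R

variable {Γ : Subgroup Rˣ}

instance : Mul (HT Γ) := ⟨fun x y =>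
  ⟨x.e * y.e, x.f * y.f, ((x.e : Rˣ) : R) * y.u + x.u, y.v + x.v * ((y.f : Rˣ) : R),
    ((x.e : Rˣ) : R) * y.w + x.u * y.v + x.w * ((y.f : Rˣ) : R)⟩⟩

instance : One (HT Γ) := ⟨⟨1, 1, 0, 0, 0⟩⟩

instance : Inv (HT Γ) := ⟨fun x =>
  ⟨x.e⁻¹, x.f⁻¹, -(((x.e⁻¹ : Γ) : Rˣ) : R) * x.u, -x.v * (((x.f⁻¹ : Γ) : Rˣ) : R),
    -(((x.e⁻¹ : Γ) : Rˣ) : R) * x.w * (((x.f⁻¹ : Γ) : Rˣ) : R) +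
      (((x.e⁻¹ : Γ) : Rˣ) : R) * x.u * x.v * (((x.f⁻¹ : Γ) : Rˣ) : R)⟩⟩

theorem HT.mul_def (x y : HT Γ) : x * y =
  ⟨x.e * y.e, x.f * y.f, ((x.e : Rˣ) : R) * y.u + x.u, y.v + x.v * ((y.f : Rˣ) : R),
    ((x.e : Rˣ) : R) * y.w + x.u * y.v + x.w * ((y.f : Rˣ) : R)⟩ := rfl

theorem HT.one_def : (1 : HT Γ) = ⟨1, 1, 0, 0, 0⟩ := rfl

theorem HT.inv_def (x : HT Γ) : x⁻¹ =
  ⟨x.e⁻¹, x.f⁻¹, -(((x.e⁻¹ : Γ) : Rˣ) : R) * x.u, -x.v * (((x.f⁻¹ : Γ) : Rˣ) : R),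
    -(((x.e⁻¹ : Γ) : Rˣ) : R) * x.w * (((x.f⁻¹ : Γ) : Rˣ) : R) +
      (((x.e⁻¹ : Γ) : Rˣ) : R) * x.u * x.v * (((x.f⁻¹ : Γ) : Rˣ) : R)⟩ := rfl

instance : Group (HT Γ) := Group.ofLeftAxioms
  (by
    intro x y z
    simp only [HT.mul_def]
    ext1
    · simp [mul_assoc]
    · simp [mul_assoc]
    · simp only [Subgroup.coe_mul, Units.val_mul]; noncomm_ring
    · simp only [Subgroup.coe_mul, Units.val_mul]; noncomm_ring
    · simp only [Subgroup.coe_mul, Units.val_mul]; noncomm_ring)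
  (by
    intro x
    simp [HT.mul_def, HT.one_def])
  (by
    intro x
    simp only [HT.mul_def, HT.one_def, HT.inv_def]
    ext1
    · simp
    · simp
    · simp
    · simp
    · simp [mul_assoc, add_mul]; abel)

theorem HT.pow_e (x : HT Γ) (n : ℕ) : (x ^ n).e = x.e ^ n := by
  induction n with
  | zero => simp [HT.one_def]
  | succ n ih => rw [pow_succ, pow_succ, ← ih]; rfl

theorem HT.pow_f (x : HT Γ) (n : ℕ) : (x ^ n).f = x.f ^ n := by
  induction n with
  | zero => simp [HT.one_def]
  | succ n ih => rw [pow_succ, pow_succ, ← ih]; rfl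

theorem HT.cube (h3 : ∀ r : R, r + r + r = 0) (x : HT Γ) (he : x.e = 1) (hf : x.f = 1) :
    x ^ 3 = 1 := by
  obtain ⟨e, f, u, v, w⟩ := x
  simp only at he hf
  subst he hf
  have hu := h3 u
  have hv := h3 v
  have hw := h3 w
  have huv := h3 (u * v)
  rw [pow_succ, pow_two]
  simp only [HT.mul_def, HT.one_def]
  ext1
  · simp
  · simp
  · simp only [OneMemClass.coe_one, Units.val_one, mul_one, one_mul]
    rw [← hu]; abel
  · simp only [OneMemClass.coe_one, Units.val_one, mul_one, one_mul]
    rw [← hv]; abel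
  · simp only [OneMemClass.coe_one, Units.val_one, mul_one, one_mul]
    calc _ = (w + w + w) + (u * v + u * v + u * v) := by noncomm_ring
      _ = 0 := by rw [hw, huv, add_zero]

theorem HT.torsion (h3 : ∀ r : R, r + r + r = 0) (hΓ : Monoid.IsTorsion Γ) :
    Monoid.IsTorsion (HT Γ) := by
  intro x
  obtain ⟨n, hn, hen⟩ := isOfFinOrder_iff_pow_eq_one.1 (hΓ x.e)
  obtain ⟨k, hk, hfk⟩ := isOfFinOrder_iff_pow_eq_one.1 (hΓ x.f)
  refine isOfFinOrder_iff_pow_eq_one.2 ⟨n * k * 3, by positivity, ?_⟩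
  rw [pow_mul]
  refine HT.cube h3 _ ?_ ?_
  · rw [HT.pow_e, pow_mul, hen, one_pow]
  · rw [HT.pow_f, mul_comm, pow_mul, hfk, one_pow]

variable (Γ) in
/-- Embedding of the upper right corner. -/
def HT.io (w : R) : HT Γ := ⟨1, 1, 0, 0, w⟩
/-- Left diagonal. -/
def HT.dl (g : Γ) : HT Γ := ⟨g, 1, 0, 0, 0⟩
/-- Right diagonal. -/
def HT.dr (g : Γ) : HT Γ := ⟨1, g, 0, 0, 0⟩
variable (Γ) in
/-- First unipotent. -/
def HT.p : HT Γ := ⟨1, 1, 1, 0, 0⟩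
variable (Γ) in
/-- Second unipotent. -/
def HT.q : HT Γ := ⟨1, 1, 0, 1, 0⟩

theorem HT.mW_pq : mW (HT.p Γ) (HT.q Γ) = HT.io Γ 1 := by
  simp [mW, HT.p, HT.q, HT.io, HT.mul_def, HT.inv_def]

theorem HT.io_mul (a b : R) : HT.io Γ a * HT.io Γ b = HT.io Γ (a + b) := by
  simp [HT.io, HT.mul_def, add_comm]

theorem HT.io_inv (a : R) : (HT.io Γ a)⁻¹ = HT.io Γ (-a) := by
  simp [HT.io, HT.inv_def]

theorem HT.dl_conj (g : Γ) (a : R) :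
    HT.dl g * HT.io Γ a * (HT.dl g)⁻¹ = HT.io Γ (((g : Rˣ) : R) * a) := by
  simp [HT.io, HT.dl, HT.mul_def, HT.inv_def]

theorem HT.dl_conj_inv (g : Γ) (a : R) :
    (HT.dl g)⁻¹ * HT.io Γ a * HT.dl g = HT.io Γ ((((g⁻¹ : Γ) : Rˣ) : R) * a) := by
  simp [HT.io, HT.dl, HT.mul_def, HT.inv_def]

theorem HT.dr_conj_inv (g : Γ) (a : R) :
    (HT.dr g)⁻¹ * HT.io Γ a * HT.dr g = HT.io Γ (a * ((g : Rˣ) : R)) := by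
  simp [HT.io, HT.dr, HT.mul_def, HT.inv_def]

theorem HT.cE_dl (g : Γ) (a : R) :
    cE (HT.dl g) (HT.io Γ a) = HT.io Γ ((((g : Rˣ) : R) - 1) * a) := by
  rw [cE, HT.dl_conj, HT.io_inv, HT.io_mul]
  congr 1; noncomm_ring

/-- The first operator. -/
def oX (g : Fin 6 → Γ) : R :=
  ((g 0 : Rˣ) : R) * (((g 3 : Rˣ) : R) - 1) + ((g 1 : Rˣ) : R) * (((g 4 : Rˣ) : R) - 1) +
    ((g 2 : Rˣ) : R) * (((g 5 : Rˣ) : R) - 1)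

/-- The second operator. -/
def oY (g : Fin 6 → Γ) : R :=
  (((g 3 : Rˣ) : R) - 1) * ((((g 0)⁻¹ : Γ) : Rˣ) : R) +
    (((g 4 : Rˣ) : R) - 1) * ((((g 1)⁻¹ : Γ) : Rˣ) : R) +
    (((g 5 : Rˣ) : R) - 1) * ((((g 2)⁻¹ : Γ) : Rˣ) : R)

theorem HT.opX_io (g : Fin 6 → Γ) (a : R) :
    opX (fun i => HT.dl (g i)) (HT.io Γ a) = HT.io Γ (oX g * a) := by
  simp only [opX, HT.cE_dl, HT.dl_conj, HT.io_mul]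
  congr 1
  simp only [oX, add_mul, mul_assoc]

theorem HT.opY_io (g : Fin 6 → Γ) (a : R) :
    opY (fun i => HT.dl (g i)) (HT.io Γ a) = HT.io Γ (oY g * a) := by
  simp only [opY, HT.dl_conj_inv, HT.cE_dl, HT.io_mul]
  congr 1
  simp only [oY, add_mul, mul_assoc]

end HTsec

/-! ### The monomial group -/

/-- The endomorphism ring. -/
abbrev EndU : Type := Module.End (ZMod 3) (ℕ → ZMod 3)

/-- The unit `r` is monomial with underlying permutation `γ`. -/
def IsMono (r : EndUˣ) (γ : Equiv.Perm ℕ) : Prop :=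
  ∃ s : ℕ → ℤˣ, ∀ (f : ℕ → ZMod 3) (n : ℕ), (r : EndU) f n = s n • f (γ⁻¹ n)

theorem IsMono.one : IsMono 1 1 := ⟨fun _ => 1, fun f n => by simp⟩

theorem IsMono.mul {r r' : EndUˣ} {γ γ' : Equiv.Perm ℕ} (h : IsMono r γ) (h' : IsMono r' γ') :
    IsMono (r * r') (γ * γ') := by
  obtain ⟨s, hs⟩ := h
  obtain ⟨s', hs'⟩ := h'
  refine ⟨fun n => s n * s' (γ⁻¹ n), fun f n => ?_⟩
  rw [Units.val_mul, Module.End.mul_apply, hs, hs', mul_smul, mul_inv_rev, Equiv.Perm.mul_apply]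

theorem IsMono.inv {r : EndUˣ} {γ : Equiv.Perm ℕ} (h : IsMono r γ) : IsMono r⁻¹ γ⁻¹ := by
  obtain ⟨s, hs⟩ := h
  refine ⟨fun n => (s (γ n))⁻¹, fun f n => ?_⟩
  have h1 := hs (((r⁻¹ : EndUˣ) : EndU) f) (γ n)
  rw [← Module.End.mul_apply, ← Units.val_mul, mul_inv_cancel] at h1
  simp only [Units.val_one, Module.End.one_apply, show γ⁻¹ (γ n) = n from γ.symm_apply_apply n] at h1
  rw [inv_inv, h1, smul_smul, inv_mul_cancel, one_smul]

theorem IsMono.pow {r : EndUˣ} {γ : Equiv.Perm ℕ} (h : IsMono r γ) (n : ℕ) :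
    IsMono (r ^ n) (γ ^ n) := by
  induction n with
  | zero => simpa using IsMono.one
  | succ n ih => rw [pow_succ, pow_succ]; exact ih.mul h

/-- Monomial units over the Grigorchuk group. -/
def Mono : Subgroup EndUˣ where
  carrier := {r | ∃ γ ∈ Grig, IsMono r γ}
  one_mem' := ⟨1, one_mem _, IsMono.one⟩
  mul_mem' := by
    rintro _ _ ⟨γ, hγ, h⟩ ⟨γ', hγ', h'⟩
    exact ⟨γ * γ', mul_mem hγ hγ', h.mul h'⟩
  inv_mem' := by
    rintro _ ⟨γ, hγ, h⟩
    exact ⟨γ⁻¹, inv_mem hγ, h.inv⟩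

theorem mono_torsion : Monoid.IsTorsion Mono := by
  rintro ⟨r, γ, hγ, h⟩
  rw [← Submonoid.isOfFinOrder_coe]
  obtain ⟨n, hn, hγn⟩ := isOfFinOrder_iff_pow_eq_one.1 (grig_torsion ⟨γ, hγ⟩)
  have hγn' : γ ^ n = 1 := congrArg Subtype.val hγn
  have h2 := h.pow n
  rw [hγn'] at h2
  obtain ⟨s, hs⟩ := h2
  refine isOfFinOrder_iff_pow_eq_one.2 ⟨n * 2, by positivity, ?_⟩
  change r ^ (n * 2) = 1
  rw [pow_mul, pow_two]
  refine Units.ext (LinearMap.ext fun f => funext fun k => ?_)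
  rw [Units.val_mul, Module.End.mul_apply, hs, hs, smul_smul, inv_one, Equiv.Perm.one_apply, ← pow_two, Int.units_sq]
  simp

theorem endU_three (r : EndU) : r + r + r = 0 := by
  refine LinearMap.ext fun f => funext fun k => ?_
  change r f k + r f k + r f k = 0
  generalize r f k = x
  revert x; decide

/-- Permutation endomorphism. -/
def mvEnd (i : Fin 3) : EndU where
  toFun f := fun n => f (mv i n)
  map_add' _ _ := rfl
  map_smul' _ _ := rfl

/-- Permutation unit. -/
def mvUnit (i : Fin 3) : EndUˣ where
  val := mvEnd i
  inv := mvEnd i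
  val_inv := LinearMap.ext fun f => funext fun n => congrArg f (mv_mv i n)
  inv_val := LinearMap.ext fun f => funext fun n => congrArg f (mv_mv i n)

open Classical in
/-- The sign of a piece. -/
noncomputable def sg (i : Fin 3) (n : ℕ) : ℤˣ := if pieceP i n then -1 else 1

/-- Sign endomorphism. -/
noncomputable def sgEnd (i : Fin 3) : EndU where
  toFun f := fun n => sg i n • f n
  map_add' _ _ := funext fun _ => smul_add _ _ _
  map_smul' c f := funext fun n => by
    change sg i n • (c * f n) = c * (sg i n • f n)
    rw [mul_smul_comm]

theorem sgEnd_sq (i : Fin 3) : sgEnd i * sgEnd i = 1 :=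
  LinearMap.ext fun f => funext fun n => by
    change sg i n • sg i n • f n = f n
    rw [smul_smul, ← pow_two, Int.units_sq, one_smul]

/-- Sign unit. -/
noncomputable def sgUnit (i : Fin 3) : EndUˣ := ⟨sgEnd i, sgEnd i, sgEnd_sq i, sgEnd_sq i⟩

theorem mvUnit_mem (i : Fin 3) : mvUnit i ∈ Mono := by
  refine ⟨(mv i)⁻¹, inv_mem (mv_mem i), fun _ => 1, fun f n => ?_⟩
  rw [inv_inv, one_smul]; rfl

theorem sgUnit_mem (i : Fin 3) : sgUnit i ∈ Mono :=
  ⟨1, one_mem _, sg i, fun f n => by rw [inv_one]; rfl⟩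

/-- The six elements. -/
noncomputable def gg : Fin 6 → Mono :=
  ![⟨mvUnit 0, mvUnit_mem 0⟩, ⟨mvUnit 1, mvUnit_mem 1⟩, ⟨mvUnit 2, mvUnit_mem 2⟩,
    ⟨sgUnit 0, sgUnit_mem 0⟩, ⟨sgUnit 1, sgUnit_mem 1⟩, ⟨sgUnit 2, sgUnit_mem 2⟩]

open Classical in
theorem sgEnd_sub (i : Fin 3) (f : ℕ → ZMod 3) (n : ℕ) :
    (sgEnd i - 1) f n = if pieceP i n then f n else 0 := by
  change sg i n • f n - f n = _
  unfold sg
  split_ifs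
  · generalize f n = x
    revert x; decide
  · simp

open Classical in
theorem oX_apply (f : ℕ → ZMod 3) (n : ℕ) :
    oX gg f n = ∑ i : Fin 3, if pieceP i (mv i n) then f (mv i n) else 0 := by
  rw [Fin.sum_univ_three, ← sgEnd_sub, ← sgEnd_sub, ← sgEnd_sub]
  rfl

open Classical in
theorem oY_apply (f : ℕ → ZMod 3) (n : ℕ) :
    oY gg f n = ∑ i : Fin 3, if pieceP i n then f (mv i n) else 0 := by
  have h : ∀ i, (if pieceP i n then f (mv i n) else 0) = (sgEnd i - 1) (mvEnd i f) n :=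
    fun i => (sgEnd_sub i (mvEnd i f) n).symm
  rw [Fin.sum_univ_three, h, h, h]
  rfl

theorem oYX : oY gg * oX gg = (1 : EndU) := by
  classical
  refine LinearMap.ext fun f => funext fun n => ?_
  rw [Module.End.mul_apply, oY_apply]
  obtain ⟨j, hj⟩ := piece_cover n
  rw [Finset.sum_eq_single j, if_pos hj, oX_apply, Finset.sum_eq_single j, mv_mv, if_pos hj]
  · rfl
  · intro i _ hi
    refine if_neg fun h => hi (image_unique _ i j h ?_)
    rwa [mv_mv]
  · simp
  · intro i _ hi
    exact if_neg fun h => hi (piece_unique n i j h hj)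
  · simp

theorem oXY : oX gg * oY gg ≠ (1 : EndU) := by
  classical
  intro h
  have h1 : (oX gg * oY gg : EndU) (fun _ => 1) 0 = 1 := by rw [h]; rfl
  rw [Module.End.mul_apply, oX_apply, Finset.sum_eq_zero] at h1
  · exact absurd h1 (by decide)
  · intro i _
    exact if_neg (image_zero i)

theorem io_injective : Function.Injective (HT.io Mono) := fun _ _ h => congrArg HT.w h

theorem torsion_example : ∃ (p q : HT Mono) (e f : Fin 6 → HT Mono),
    (∀ i, f i * p = p * f i) ∧ (∀ i, e i * q = q * e i) ∧
    (mW p q * p = p * mW p q) ∧ (mW p q * q = q * mW p q) ∧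
    (∀ i j, e i * f j = f j * e i) ∧
    (∀ i, e i * mW p q * (e i)⁻¹ = (f i)⁻¹ * mW p q * f i) ∧
    opY e (opX e (mW p q)) = mW p q ∧ opX e (opY e (mW p q)) ≠ mW p q := by
  refine ⟨HT.p Mono, HT.q Mono, fun i => HT.dl (gg i), fun i => HT.dr (gg i),
    ?_, ?_, ?_, ?_, ?_, ?_, ?_, ?_⟩
  · intro i; simp [HT.p, HT.dr, HT.mul_def]
  · intro i; simp [HT.q, HT.dl, HT.mul_def]
  · rw [HT.mW_pq]; simp [HT.p, HT.io, HT.mul_def]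
  · rw [HT.mW_pq]; simp [HT.q, HT.io, HT.mul_def]
  · intro i j; simp [HT.dl, HT.dr, HT.mul_def]
  · intro i; rw [HT.mW_pq, HT.dl_conj, HT.dr_conj_inv, mul_one, one_mul]
  · rw [HT.mW_pq, HT.opX_io, HT.opY_io, ← mul_assoc, oYX, one_mul]
  · rw [HT.mW_pq, HT.opY_io, HT.opX_io, ← mul_assoc, mul_one]
    exact fun h => oXY (io_injective h)

/-! ### The universal sentence -/

/-- Terms in fourteen variables. -/
abbrev Tm : Type := grpLang.Term (Empty ⊕ Fin 14)

instance : Mul Tm := ⟨fun a b =>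
  FirstOrder.Language.Functions.apply₂ (L := grpLang) (show grpLang.Functions 2 from ()) a b⟩
instance : Inv Tm := ⟨fun a =>
  FirstOrder.Language.Functions.apply₁ (L := grpLang) (show grpLang.Functions 1 from ()) a⟩

theorem realize_mul {G : Type} [Group G] (v : Empty ⊕ Fin 14 → G) (a b : Tm) :
    (a * b).realize v = a.realize v * b.realize v := rfl

theorem realize_inv {G : Type} [Group G] (v : Empty ⊕ Fin 14 → G) (a : Tm) :
    (a⁻¹).realize v = (a.realize v)⁻¹ := rfl

/-- Variables. -/
def vr (i : Fin 14) : Tm := FirstOrder.Language.Term.var (Sum.inr i)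

/-- The variable `p`. -/
def tp : Tm := vr 0
/-- The variable `q`. -/
def tq : Tm := vr 1
/-- The variables `e`. -/
def te (i : Fin 6) : Tm := vr (Fin.castLE (by norm_num) (Fin.natAdd 2 i))
/-- The variables `f`. -/
def tf (i : Fin 6) : Tm := vr (Fin.natAdd 8 i)

/-- Hypotheses of the sentence. -/
def eqList : List (Tm × Tm) :=
  (List.finRange 6).map (fun i => (tf i * tp, tp * tf i)) ++
  ((List.finRange 6).map (fun i => (te i * tq, tq * te i)) ++
  ([(mW tp tq * tp, tp * mW tp tq), (mW tp tq * tq, tq * mW tp tq),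
    (opY te (opX te (mW tp tq)), mW tp tq)] ++
  ((List.finRange 6).flatMap (fun i => (List.finRange 6).map fun j =>
    (te i * tf j, tf j * te i)) ++
  (List.finRange 6).map (fun i => (te i * mW tp tq * (te i)⁻¹, (tf i)⁻¹ * mW tp tq * tf i)))))

/-- Implication from a list of equations. -/
def impl (l : List (Tm × Tm)) (c : Tm × Tm) : grpLang.BoundedFormula Empty 14 :=
  l.foldr (fun t φ => (t.1.bdEqual t.2).imp φ) (c.1.bdEqual c.2)

theorem impl_isQF (l : List (Tm × Tm)) (c : Tm × Tm) : (impl l c).IsQF := by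
  induction l with
  | nil => exact (FirstOrder.Language.BoundedFormula.IsAtomic.equal _ _).isQF
  | cons t l ih => exact (FirstOrder.Language.BoundedFormula.IsAtomic.equal _ _).isQF.imp ih

theorem impl_realize {G : Type} [Group G] (v : Empty → G) (x : Fin 14 → G)
    (l : List (Tm × Tm)) (c : Tm × Tm) : (impl l c).Realize v x ↔
      ((∀ t ∈ l, t.1.realize (Sum.elim v x) = t.2.realize (Sum.elim v x)) →
        c.1.realize (Sum.elim v x) = c.2.realize (Sum.elim v x)) := by
  induction l with
  | nil => simp [impl]
  | cons t l ih =>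
    have : impl (t :: l) c = (t.1.bdEqual t.2).imp (impl l c) := rfl
    rw [this, FirstOrder.Language.BoundedFormula.realize_imp, ih,
      FirstOrder.Language.BoundedFormula.realize_bdEqual]
    simp only [List.forall_mem_cons]
    tauto

/-- The sentence. -/
def sent : grpLang.Sentence :=
  (impl eqList (opX te (opY te (mW tp tq)), mW tp tq)).alls

theorem sent_realize (G : Type) [Group G] : G ⊨ sent ↔
    ∀ (p q : G) (e f : Fin 6 → G),
    (∀ i, f i * p = p * f i) → (∀ i, e i * q = q * e i) →
    (mW p q * p = p * mW p q) → (mW p q * q = q * mW p q) →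
    (∀ i j, e i * f j = f j * e i) →
    (∀ i, e i * mW p q * (e i)⁻¹ = (f i)⁻¹ * mW p q * f i) →
    opY e (opX e (mW p q)) = mW p q → opX e (opY e (mW p q)) = mW p q := by
  have h1 : G ⊨ sent ↔ ∀ x : Fin 14 → G,
      (impl eqList (opX te (opY te (mW tp tq)), mW tp tq)).Realize default x :=
    FirstOrder.Language.BoundedFormula.realize_alls
  have h2 : ∀ v : Empty ⊕ Fin 14 → G, ((mW tp tq : Tm).realize v) = mW (tp.realize v) (tq.realize v) := fun v => rfl
  have hX : ∀ (v : Empty ⊕ Fin 14 → G) (z : Tm), (opX te z).realize v =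
    opX (fun i => (te i).realize v) (z.realize v) := fun v z => rfl
  have hY : ∀ (v : Empty ⊕ Fin 14 → G) (z : Tm), (opY te z).realize v =
    opY (fun i => (te i).realize v) (z.realize v) := fun v z => rfl
  have key : ∀ v : Empty ⊕ Fin 14 → G, (∀ t ∈ eqList, t.1.realize v = t.2.realize v) ↔
    (∀ i, (tf i).realize v * tp.realize v = tp.realize v * (tf i).realize v) ∧
    (∀ i, (te i).realize v * tq.realize v = tq.realize v * (te i).realize v) ∧
    (mW (tp.realize v) (tq.realize v) * tp.realize v =
      tp.realize v * mW (tp.realize v) (tq.realize v)) ∧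
    (mW (tp.realize v) (tq.realize v) * tq.realize v =
      tq.realize v * mW (tp.realize v) (tq.realize v)) ∧
    (opY (fun i => (te i).realize v) (opX (fun i => (te i).realize v)
      (mW (tp.realize v) (tq.realize v))) = mW (tp.realize v) (tq.realize v)) ∧
    (∀ i j, (te i).realize v * (tf j).realize v = (tf j).realize v * (te i).realize v) ∧
    (∀ i, (te i).realize v * mW (tp.realize v) (tq.realize v) * ((te i).realize v)⁻¹ =
      ((tf i).realize v)⁻¹ * mW (tp.realize v) (tq.realize v) * (tf i).realize v) := by
    intro v
    simp only [eqList, List.forall_mem_append, List.forall_mem_map, List.forall_mem_cons,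
      List.forall_mem_flatMap, List.mem_finRange, true_imp_iff, realize_mul, realize_inv, h2, hX, hY,
      List.not_mem_nil, false_imp_iff, implies_true, and_true, and_assoc]
  rw [h1]
  constructor
  · intro h p q e f a1 a2 a3 a4 a5 a6 a7
    have hx := h (Fin.append (Fin.append ![p, q] e) f)
    rw [impl_realize, key] at hx
    have hp : tp.realize (Sum.elim (default : Empty → G) (Fin.append (Fin.append ![p, q] e) f)) = p := rfl
    have hq : tq.realize (Sum.elim (default : Empty → G) (Fin.append (Fin.append ![p, q] e) f)) = q := rfl
    have he : ∀ i, (te i).realize (Sum.elim (default : Empty → G)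
      (Fin.append (Fin.append ![p, q] e) f)) = e i := by
      intro i; fin_cases i <;> rfl
    have hf : ∀ i, (tf i).realize (Sum.elim (default : Empty → G)
      (Fin.append (Fin.append ![p, q] e) f)) = f i := by
      intro i; fin_cases i <;> rfl
    simp only [hX, hY, h2, hp, hq, he, hf] at hx
    exact hx ⟨a1, a2, a3, a4, a7, a5, a6⟩
  · intro h x
    rw [impl_realize, key]
    rintro ⟨a1, a2, a3, a4, a7, a5, a6⟩
    simp only [hX, hY, h2]
    exact h _ _ _ _ a1 a2 a3 a4 a5 a6 a7

end TorsionFinite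

/-- The universal theory of the class of torsion groups is strictly contained in the
universal theory of the class of finite groups: every universal sentence true in all
torsion groups is true in all finite groups, and some universal sentence true in every
finite group fails in some torsion group. -/
theorem univTheory_torsion_ssubset_univTheory_finite :
    UnivTheoryOf (fun G inst => letI := inst; Monoid.IsTorsion G) ⊆
        UnivTheoryOf (fun G _ => Finite G) ∧
      ∃ φ ∈ UnivTheoryOf (fun G _ => Finite G),
        ∃ (H : Type) (inst : Group H), letI := inst;
          Monoid.IsTorsion H ∧ ¬ H ⊨ φ := by

  refine ⟨fun φ hφ => ⟨hφ.1, fun G inst hG => hφ.2 G ?_⟩, TorsionFinite.sent,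
    ⟨⟨14, _, TorsionFinite.impl_isQF _ _, rfl⟩, fun G inst hG => ?_⟩,
    TorsionFinite.HT TorsionFinite.Mono, inferInstance,
    TorsionFinite.HT.torsion TorsionFinite.endU_three TorsionFinite.mono_torsion, ?_⟩
  · haveI : Finite G := hG
    exact fun g => isOfFinOrder_of_finite g
  · haveI : Finite G := hG
    rw [TorsionFinite.sent_realize]
    intro p q e f a1 a2 a3 a4 a5 a6 a7
    exact TorsionFinite.finite_lemma p q e f a1 a2 a3 a4 a5 a6 a7
  · intro h
    rw [TorsionFinite.sent_realize] at h
    obtain ⟨p, q, e, f, a1, a2, a3, a4, a5, a6, a7, a8⟩ := TorsionFinite.torsion_example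
    exact a8 (h p q e f a1 a2 a3 a4 a5 a6 a7)
end

section
/- There exist natural numbers s, t, a family R : Fin t → FreeGroup (Fin s) of relators, and a word W ∈ FreeGroup (Fin s) with the following two properties: (1) for every finite group K and every map x : Fin s → K, if the evaluation of R j at x equals 1 for all j, then the evaluation of W at x equals 1; and (2) there exist a torsion group H and a map x : Fin s → H such that the evaluation of R j at x equals 1 for all j, but the evaluation of W at x is not 1. -/
open FirstOrder

/-- The letters of the Grigorchuk group: `none` is `a`, `some j` the three other involutions. -/
abbrev GLetter := Option (Fin 3)

/-- `gTheta j k` tells whether the `j`-th involution swaps `2 * k - 1` and `2 * k`. -/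
def gTheta (j : Fin 3) (k : ℕ) : Bool := decide (padicValNat 2 k % 3 ≠ j.val)

/-- the action of the letters -/
def gFun : GLetter → ℕ → ℕ
  | none, n => if n % 2 = 0 then n + 1 else n - 1
  | some j, n =>
      if n = 0 then 0
      else if gTheta j ((n + 1) / 2) then (if n % 2 = 1 then n + 1 else n - 1) else n

theorem gFun_pos {j : Fin 3} {n : ℕ} (h0 : n ≠ 0) (ht : gTheta j ((n + 1) / 2) = true) :
    gFun (some j) n = if n % 2 = 1 then n + 1 else n - 1 := by
  simp only [gFun]; rw [if_neg h0, if_pos ht]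

theorem gFun_neg {j : Fin 3} {n : ℕ} (ht : ¬ gTheta j ((n + 1) / 2) = true) :
    gFun (some j) n = n := by
  simp only [gFun]; rw [if_neg ht]; split_ifs <;> omega

theorem gFun_zero (j : Fin 3) : gFun (some j) 0 = 0 := by simp [gFun]

theorem gFun_invol (l : GLetter) : Function.Involutive (gFun l) := by
  intro n
  cases l with
  | none => simp only [gFun]; split_ifs <;> omega
  | some j =>
    by_cases h0 : n = 0
    · simp [gFun, h0]
    by_cases ht : gTheta j ((n + 1) / 2)
    · rcases Nat.mod_two_eq_zero_or_one n with h | h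
      · have e : (n - 1 + 1) / 2 = (n + 1) / 2 := by omega
        have h1 : n - 1 ≠ 0 := by omega
        have h2 : (n - 1) % 2 = 1 := by omega
        simp only [gFun, h0, ht, h, if_true, if_false, zero_ne_one, h1, e, h2]
        omega
      · have e : (n + 1 + 1) / 2 = (n + 1) / 2 := by omega
        have h1 : n + 1 ≠ 0 := by omega
        have h2 : ¬ (n + 1) % 2 = 1 := by omega
        simp only [gFun, h0, ht, h, if_true, if_false, h1, e, h2]
        omega
    · simp [gFun, h0, ht]

/-- letters as permutations -/
noncomputable def gPerm (l : GLetter) : Equiv.Perm ℕ := (gFun_invol l).toPerm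

theorem gPerm_apply (l : GLetter) (n : ℕ) : gPerm l n = gFun l n := rfl

theorem gPerm_sq (l : GLetter) : gPerm l * gPerm l = 1 := by
  ext n; exact gFun_invol l n

/-- the two halves of `ℕ` -/
def gHalf : Bool → ℕ → ℕ
  | false, m => 2 * m + m % 2
  | true, m => 2 * m + 1 - m % 2

theorem gHalf_cover (n : ℕ) : ∃ e m, n = gHalf e m := by
  by_cases h : n % 2 = (n / 2) % 2
  · exact ⟨false, n / 2, by simp only [gHalf]; omega⟩
  · exact ⟨true, n / 2, by simp only [gHalf]; omega⟩

theorem gTheta_double (j : Fin 3) (k : ℕ) (hk : k ≠ 0) :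
    gTheta j (2 * k) = gTheta (j - 1) k := by
  unfold gTheta
  rw [padicValNat.mul (by norm_num) hk, padicValNat.self (by norm_num), decide_eq_decide]
  fin_cases j <;> simp <;> omega

theorem gTheta_odd (j : Fin 3) (k : ℕ) (hk : k % 2 = 1) :
    gTheta j k = decide (j ≠ 0) := by
  unfold gTheta
  rw [padicValNat.eq_zero_of_not_dvd (by omega)]
  fin_cases j <;> simp

/-- section words of a letter -/
def gSec : GLetter → Bool → List GLetter
  | none, _ => []
  | some j, false => [some (j - 1)]
  | some j, true => if j = 0 then [] else [none]

/-- action of the letters on the index of the half -/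
def gTop : GLetter → Bool → Bool
  | none, e => !e
  | some _, e => e

/-- evaluation of words -/
noncomputable def gEval (w : List GLetter) : Equiv.Perm ℕ := (w.map gPerm).prod

@[simp] theorem gEval_nil : gEval [] = 1 := rfl
@[simp] theorem gEval_cons (l w) : gEval (l :: w) = gPerm l * gEval w := by simp [gEval]
@[simp] theorem gEval_append (v w) : gEval (v ++ w) = gEval v * gEval w := by simp [gEval]

theorem gPerm_half (l : GLetter) (e : Bool) (m : ℕ) :
    gPerm l (gHalf e m) = gHalf (gTop l e) (gEval (gSec l e) m) := by
  cases l with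
  | none =>
    cases e <;> simp only [gPerm_apply, gFun, gHalf, gTop, gSec, Bool.not_false, Bool.not_true,
      gEval_nil, Equiv.Perm.one_apply] <;> split_ifs <;> omega
  | some j =>
    cases e with
    | false =>
      simp only [gSec, gEval_cons, gEval_nil, mul_one, gTop, gPerm_apply]
      by_cases h0 : m = 0
      · simp [h0, gFun, gHalf]
      have h1 : gHalf false m ≠ 0 := by simp only [gHalf]; omega
      have h2 : (gHalf false m + 1) / 2 = 2 * ((m + 1) / 2) := by simp only [gHalf]; omega
      have h3 := gTheta_double j ((m + 1) / 2) (by omega)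
      rw [← h2] at h3
      by_cases ht : gTheta (j - 1) ((m + 1) / 2) = true
      · rw [gFun_pos h1 (by rw [h3, ht]), gFun_pos h0 ht]
        by_cases hm : m % 2 = 1
        · rw [if_pos hm, if_pos (by simp only [gHalf]; omega)]; simp only [gHalf]; omega
        · rw [if_neg hm, if_neg (by simp only [gHalf]; omega)]; simp only [gHalf]; omega
      · rw [gFun_neg (by rw [h3]; exact ht), gFun_neg ht]
    | true =>
      have h1 : gHalf true m ≠ 0 := by simp only [gHalf]; omega
      have h2 : ((gHalf true m + 1) / 2) % 2 = 1 := by simp only [gHalf]; omega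
      have h3 := gTheta_odd j _ h2
      simp only [gTop, gPerm_apply, gSec]
      by_cases hj : j = 0
      · rw [gFun_neg (by rw [h3]; simp [hj])]; simp [hj]
      · rw [gFun_pos h1 (by simp [h3, hj]), if_neg hj]
        simp only [gEval_cons, gEval_nil, mul_one, gPerm_apply, gFun]
        by_cases hm : m % 2 = 0
        · rw [if_pos hm, if_pos (by simp only [gHalf]; omega)]; simp only [gHalf]; omega
        · rw [if_neg hm, if_neg (by simp only [gHalf]; omega)]; simp only [gHalf]; omega

theorem gPerm_klein (i j : Fin 3) (h : i ≠ j) :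
    gPerm (some i) * gPerm (some j) = gPerm (some (-(i + j))) := by
  have key : ∀ k, (gTheta (-(i+j)) k = true) ↔
      ¬ ((gTheta i k = true) ↔ (gTheta j k = true)) := by
    intro k
    unfold gTheta
    have : padicValNat 2 k % 3 < 3 := Nat.mod_lt _ (by norm_num)
    generalize padicValNat 2 k % 3 = r at *
    interval_cases r <;> revert h <;> revert i j <;> decide
  ext n
  simp only [Equiv.Perm.mul_apply, gPerm_apply]
  by_cases h0 : n = 0
  · simp [gFun, h0]
  have kk := key ((n+1)/2)
  generalize -(i + j) = k at *
  by_cases hj : gTheta j ((n+1)/2) = true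
  · by_cases hi : gTheta i ((n+1)/2) = true
    · have e : gFun (some j) n = gFun (some i) n := by rw [gFun_pos h0 hi, gFun_pos h0 hj]
      rw [e, gFun_invol, gFun_neg (by tauto)]
    · have h3 : gTheta k ((n+1)/2) = true := by tauto
      have e : gFun (some j) n = gFun (some k) n := by rw [gFun_pos h0 h3, gFun_pos h0 hj]
      have e2 : (gFun (some k) n + 1) / 2 = (n+1)/2 := by
        rw [gFun_pos h0 h3]; split_ifs <;> omega
      rw [e, gFun_neg (by rw [e2]; exact hi)]
  · rw [gFun_neg hj]
    by_cases hi : gTheta i ((n+1)/2) = true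
    · rw [gFun_pos h0 hi, gFun_pos h0 (by tauto)]
    · rw [gFun_neg hi, gFun_neg (by tauto)]

/-- weights -/
def gWt : GLetter → ℕ
  | none => 3
  | some j => j.val + 2

/-- weight of a word -/
def gWord (w : List GLetter) : ℕ := (w.map gWt).sum
@[simp] theorem gWord_nil : gWord [] = 0 := rfl
@[simp] theorem gWord_cons (l w) : gWord (l :: w) = gWt l + gWord w := by simp [gWord]
@[simp] theorem gWord_append (v w) : gWord (v ++ w) = gWord v + gWord w := by simp [gWord]

/-- section words; the rightmost letter acts first -/
def gSecW : List GLetter → Bool → List GLetter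
  | [], _ => []
  | l :: w, e => gSec l (w.foldr gTop e) ++ gSecW w e

theorem gEval_half (w : List GLetter) (e : Bool) (m : ℕ) :
    gEval w (gHalf e m) = gHalf (w.foldr gTop e) (gEval (gSecW w e) m) := by
  induction w with
  | nil => simp [gSecW]
  | cons l w ih => simp [gSecW, ih, gPerm_half]

theorem gTop_foldr_not (w : List GLetter) (e : Bool) :
    w.foldr gTop (!e) = !(w.foldr gTop e) := by
  induction w with
  | nil => rfl
  | cons l w ih => simp only [List.foldr_cons, ih]; cases l <;> simp [gTop]

theorem gSec_wt (l : GLetter) (e : Bool) :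
    gWord (gSec l e) + gWord (gSec l (!e)) = if l = none then 0 else gWt l + 2 := by
  revert l e; decide

theorem gSecW_wt (w : List GLetter) :
    gWord (gSecW w false) + gWord (gSecW w true) + 5 * w.count none = gWord w + 2 * w.length := by
  induction w with
  | nil => simp [gSecW]
  | cons l w ih =>
    have h := gSec_wt l (w.foldr gTop false)
    rw [← gTop_foldr_not] at h
    simp only [gSecW, gWord_append, gWord_cons, List.length_cons, List.count_cons]
    simp only [Bool.not_false] at h
    cases l with
    | none => simp [gWt] at *; omega
    | some j => simp at *; omega

/-- an optional Klein letter as a word -/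
def gK : Option (Fin 3) → List GLetter
  | none => []
  | some j => [some j]

/-- alternating words -/
def gAlt (L : List (Option (Fin 3))) : List GLetter := L.flatMap fun k => gK k ++ [none]

@[simp] theorem gAlt_nil : gAlt [] = [] := rfl
@[simp] theorem gAlt_cons (k L) : gAlt (k :: L) = gK k ++ [none] ++ gAlt L := by simp [gAlt]
@[simp] theorem gAlt_append (L M) : gAlt (L ++ M) = gAlt L ++ gAlt M := by simp [gAlt]

theorem gAlt_count (L) : (gAlt L).length ≤ 2 * (gAlt L).count none ∧
    L.length = (gAlt L).count none := by
  induction L with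
  | nil => simp
  | cons k L ih => cases k <;> simp [gK, List.count_cons] <;> omega

theorem gK_mul (k l : Option (Fin 3)) :
    ∃ m, gEval (gK k) * gEval (gK l) = gEval (gK m) ∧
      gWord (gK m) ≤ gWord (gK k) + gWord (gK l) := by
  cases k with
  | none => exact ⟨l, by simp [gK], by simp [gK]⟩
  | some i =>
    cases l with
    | none => exact ⟨some i, by simp [gK], by simp [gK]⟩
    | some j =>
      by_cases h : i = j
      · subst h; exact ⟨none, by simp [gK, gPerm_sq], by simp [gK]⟩
      · refine ⟨some (-(i+j)), by simp [gK, gPerm_klein i j h], ?_⟩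
        revert i j; decide

theorem gNormal (w : List GLetter) : ∃ L k, gEval w = gEval (gAlt L) * gEval (gK k) ∧
    gWord (gAlt L) + gWord (gK k) ≤ gWord w := by
  induction w using List.reverseRecOn with
  | nil => exact ⟨[], none, by simp [gK], by simp [gK]⟩
  | append_singleton w l ih =>
    obtain ⟨L, k, h1, h2⟩ := ih
    cases l with
    | none =>
      refine ⟨L ++ [k], none, ?_, ?_⟩
      · simp [h1, gK, mul_assoc]
      · have h0 : gWord (gK none) = 0 := rfl
        simp only [gAlt_append, gAlt_cons, gAlt_nil, gWord_append, gWord_cons, gWord_nil, h0]; omega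
    | some j =>
      obtain ⟨m, h3, h4⟩ := gK_mul k (some j)
      refine ⟨L, m, ?_, ?_⟩
      · rw [← h3]; simp [h1, gK, mul_assoc]
      · simp only [gWord_append, gWord_cons, gWord_nil] at *
        have : gWord (gK (some j)) = gWt (some j) := by simp [gK]
        omega

theorem gK_fin (k) : IsOfFinOrder (gEval (gK k)) := by
  rw [isOfFinOrder_iff_pow_eq_one]
  refine ⟨2, by norm_num, ?_⟩
  cases k <;> simp [gK, sq, gPerm_sq]

theorem gFin_of_sections (w : List GLetter)
    (ih : ∀ v, gWord v ≤ gWord (gSecW w false) + gWord (gSecW w true) →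
      IsOfFinOrder (gEval v)) : IsOfFinOrder (gEval w) := by
  have key : ∀ (g : Equiv.Perm ℕ) (h : Bool → Equiv.Perm ℕ),
      (∀ e m, g (gHalf e m) = gHalf e (h e m)) → (∀ e, IsOfFinOrder (h e)) →
      IsOfFinOrder g := by
    intro g h hg hh
    obtain ⟨n, hn, h0⟩ := isOfFinOrder_iff_pow_eq_one.1 (hh false)
    obtain ⟨n', hn', h1⟩ := isOfFinOrder_iff_pow_eq_one.1 (hh true)
    have hp : ∀ k e m, (g ^ k) (gHalf e m) = gHalf e ((h e ^ k) m) := by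
      intro k
      induction k with
      | zero => simp
      | succ k ihk => intro e m; rw [pow_succ', pow_succ', Equiv.Perm.mul_apply, ihk, hg]; rfl
    rw [isOfFinOrder_iff_pow_eq_one]
    refine ⟨n * n', Nat.mul_pos hn hn', ?_⟩
    ext x
    obtain ⟨e, m, rfl⟩ := gHalf_cover x
    rw [hp]
    cases e
    · rw [pow_mul, h0]; simp
    · rw [mul_comm, pow_mul, h1]; simp
  cases hw : w.foldr gTop false with
  | false =>
    have hw' := gTop_foldr_not w false
    rw [hw] at hw'
    apply key _ (fun e => gEval (gSecW w e))
    · intro e m; rw [gEval_half]; cases e <;> simp_all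
    · intro e; apply ih; cases e <;> omega
  | true =>
    have hw' := gTop_foldr_not w false
    rw [hw] at hw'
    have : IsOfFinOrder (gEval w * gEval w) := by
      apply key _ (fun e => gEval (gSecW w (!e) ++ gSecW w e))
      · intro e m; rw [Equiv.Perm.mul_apply, gEval_half, gEval_half]
        cases e <;> simp_all
      · intro e; apply ih; cases e <;> simp <;> omega
    rw [← sq] at this
    exact (isOfFinOrder_pow.1 this).resolve_right (by norm_num)

theorem gEval_fin (n : ℕ) : ∀ w, gWord w ≤ n → IsOfFinOrder (gEval w) := by
  induction n using Nat.strong_induction_on with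
  | _ n ih =>
    intro w hw
    obtain ⟨L, k, h1, h2⟩ := gNormal w
    rw [h1]
    cases L with
    | nil => simpa using gK_fin k
    | cons k' L =>
      obtain ⟨m, h3, h4⟩ := gK_mul k k'
      have h5 : gEval (gAlt (m :: L)) =
          (gEval (gK k)) * (gEval (gAlt (k' :: L)) * gEval (gK k)) * (gEval (gK k))⁻¹ := by
        simp only [gAlt_cons, gEval_append, ← h3]; group
      have h6 : IsOfFinOrder (gEval (gAlt (m :: L))) := by
        apply gFin_of_sections
        intro v hv
        have c1 := gSecW_wt (gAlt (m :: L))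
        have c2 := gAlt_count (m :: L)
        have c3 : gWord (gAlt (m :: L)) ≤ n := by simp at *; omega
        have c4 : (m :: L).length ≥ 1 := by simp
        exact ih (gWord v) (by omega) v le_rfl
      rw [h5] at h6
      have := (MulAut.conj (gEval (gK k))⁻¹ : Equiv.Perm ℕ →* Equiv.Perm ℕ).isOfFinOrder h6
      simpa [mul_assoc] using this

/-- the Grigorchuk group as the set of evaluations of words -/
def gSub : Submonoid (Equiv.Perm ℕ) where
  carrier := {g | ∃ w, g = gEval w}
  one_mem' := ⟨[], rfl⟩
  mul_mem' := by rintro _ _ ⟨v, rfl⟩ ⟨w, rfl⟩; exact ⟨v ++ w, by simp⟩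

theorem gPerm_mem (l) : gPerm l ∈ gSub := ⟨[l], by simp⟩

theorem gSub_fin {g} (h : g ∈ gSub) : IsOfFinOrder g := by
  obtain ⟨w, rfl⟩ := h; exact gEval_fin _ w le_rfl

/-- the ring of operators -/
abbrev MonR := Module.End (ZMod 3) (ℕ → ZMod 3)

/-- monomial operators with permutation part in the Grigorchuk group -/
def monSub : Submonoid MonR where
  carrier := {u | ∃ (s : ℕ → ZMod 3) (π : Equiv.Perm ℕ), π ∈ gSub ∧ (∀ n, s n * s n = 1) ∧
    ∀ f n, u f n = s n * f (π n)}
  one_mem' := ⟨fun _ => 1, 1, gSub.one_mem, by simp, by simp⟩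
  mul_mem' := by
    rintro u v ⟨s, π, h1, h2, h3⟩ ⟨s', π', h1', h2', h3'⟩
    refine ⟨fun n => s n * s' (π n), π' * π, gSub.mul_mem h1' h1, ?_, ?_⟩
    · intro n
      calc s n * s' (π n) * (s n * s' (π n)) = (s n * s n) * (s' (π n) * s' (π n)) := by ring
        _ = 1 := by rw [h2, h2', one_mul]
    · intro f n
      rw [Module.End.mul_apply, h3, h3', mul_assoc]; rfl

theorem monSub_fin {u} (hu : u ∈ monSub) : IsOfFinOrder u := by
  obtain ⟨s, π, h1, h2, h3⟩ := hu
  obtain ⟨N, hN, hp⟩ := isOfFinOrder_iff_pow_eq_one.1 (gSub_fin h1)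
  have hk : ∀ k, ∃ t : ℕ → ZMod 3, (∀ n, t n * t n = 1) ∧
      ∀ f n, (u ^ k) f n = t n * f ((π ^ k) n) := by
    intro k
    induction k with
    | zero => exact ⟨fun _ => 1, by simp, by simp⟩
    | succ k ih =>
      obtain ⟨t, ht, hf⟩ := ih
      refine ⟨fun n => s n * t (π n), ?_, ?_⟩
      · intro n
        calc s n * t (π n) * (s n * t (π n)) = (s n * s n) * (t (π n) * t (π n)) := by ring
          _ = 1 := by rw [h2, ht, one_mul]
      · intro f n
        rw [pow_succ', Module.End.mul_apply, h3, hf, mul_assoc, pow_succ]; rfl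
  obtain ⟨t, ht, hf⟩ := hk N
  rw [isOfFinOrder_iff_pow_eq_one]
  refine ⟨N * 2, by omega, ?_⟩
  rw [pow_mul, sq]
  ext1 i
  ext n
  simp only [LinearMap.comp_apply, Module.End.mul_apply, hf, hp, Equiv.Perm.one_apply,
    Module.End.one_apply]
  rw [← mul_assoc, ht, one_mul]

/-- a monomial operator -/
def monoOp (s : ℕ → ZMod 3) (π : Equiv.Perm ℕ) : MonR where
  toFun f n := s n * f (π n)
  map_add' f g := by ext n; simp [mul_add]
  map_smul' c f := by ext n; simp; ring

/-- sign function of a decidable set -/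
def sgnB (b : ℕ → Bool) (n : ℕ) : ZMod 3 := if b n = true then 1 else -1

theorem monoOp_mem (b : ℕ → Bool) (l : GLetter) : monoOp (sgnB b) (gPerm l) ∈ monSub :=
  ⟨sgnB b, gPerm l, gPerm_mem l, fun n => by simp only [sgnB]; split_ifs <;> simp, fun _ _ => rfl⟩

/-- letters used in the shift -/
def tL : Fin 3 → GLetter := ![none, some 2, some 1]

/-- pieces for the forward shift -/
def fwd : Fin 3 → ℕ → Bool := ![fun n => n % 2 = 0,
  fun n => n % 2 = 1 ∧ gTheta 2 ((n + 1) / 2) = true,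
  fun n => n % 2 = 1 ∧ ¬ gTheta 2 ((n + 1) / 2) = true]

/-- pieces for the backward shift -/
def bwd : Fin 3 → ℕ → Bool := ![fun n => n % 2 = 1,
  fun n => n ≠ 0 ∧ n % 2 = 0 ∧ gTheta 2 ((n + 1) / 2) = true,
  fun n => n ≠ 0 ∧ n % 2 = 0 ∧ ¬ gTheta 2 ((n + 1) / 2) = true]

/-- generators: plain letters, forward pieces, backward pieces -/
noncomputable def gens : Fin 3 × Fin 3 → MonR := fun a =>
  monoOp (sgnB (![fun _ => true, fwd a.2, bwd a.2] a.1)) (gPerm (tL a.2))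

theorem gens_mem (a) : gens a ∈ monSub := monoOp_mem _ _

/-- forward list -/
def lX : List (Fin 3 × Fin 3) := [(0, 0), (1, 0), (0, 1), (1, 1), (0, 2), (1, 2)]
/-- backward list -/
def lY : List (Fin 3 × Fin 3) := [(0, 0), (2, 0), (0, 1), (2, 1), (0, 2), (2, 2)]

theorem gTheta_one_of {k} (h : ¬ gTheta 2 k = true) : gTheta 1 k = true := by
  simp [gTheta] at *; omega

theorem sgnB_true (n : ℕ) : sgnB (fun _ => true) n = 1 := by simp [sgnB]

theorem monoOp_apply (s π f n) : monoOp s π f n = s n * f (π n) := rfl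

theorem X_apply (f : ℕ → ZMod 3) (n : ℕ) : (lX.map gens).sum f n = - f (n + 1) := by
  have h2 : (1 : ZMod 3) + 1 = -1 := by decide
  have key : (lX.map gens).sum f n =
      (1 + sgnB (fwd 0) n) * f (gFun none n) + (1 + sgnB (fwd 1) n) * f (gFun (some 2) n) +
        (1 + sgnB (fwd 2) n) * f (gFun (some 1) n) := by
    simp [lX, gens, monoOp_apply, tL, sgnB_true, gPerm_apply]; ring
  rw [key]
  by_cases hn : n % 2 = 0
  · have h : gFun none n = n + 1 := by simp [gFun, hn]
    simp [sgnB, fwd, hn, h, h2]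
  · have hn1 : n % 2 = 1 := by omega
    have hn0 : n ≠ 0 := by omega
    by_cases ht : gTheta 2 ((n + 1) / 2) = true
    · have h : gFun (some 2) n = n + 1 := by rw [gFun_pos hn0 ht, if_pos hn1]
      simp [sgnB, fwd, hn1, h, h2, ht]
    · have h : gFun (some 1) n = n + 1 := by rw [gFun_pos hn0 (gTheta_one_of ht), if_pos hn1]
      simp [sgnB, fwd, hn1, h, h2, ht]

theorem Y_apply (f : ℕ → ZMod 3) (n : ℕ) :
    (lY.map gens).sum f n = if n = 0 then 0 else - f (n - 1) := by
  have h2 : (1 : ZMod 3) + 1 = -1 := by decide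
  have key : (lY.map gens).sum f n =
      (1 + sgnB (bwd 0) n) * f (gFun none n) + (1 + sgnB (bwd 1) n) * f (gFun (some 2) n) +
        (1 + sgnB (bwd 2) n) * f (gFun (some 1) n) := by
    simp [lY, gens, monoOp_apply, tL, sgnB_true, gPerm_apply]; ring
  rw [key]
  by_cases h0 : n = 0
  · simp [h0, sgnB, bwd]
  rw [if_neg h0]
  by_cases hn : n % 2 = 1
  · have h : gFun none n = n - 1 := by simp [gFun, hn]
    simp [sgnB, bwd, hn, h, h2]
  · have hn1 : n % 2 = 0 := by omega
    by_cases ht : gTheta 2 ((n + 1) / 2) = true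
    · have h : gFun (some 2) n = n - 1 := by rw [gFun_pos h0 ht, if_neg hn]
      simp [sgnB, bwd, hn1, h, h2, ht, h0]
    · have h : gFun (some 1) n = n - 1 := by rw [gFun_pos h0 (gTheta_one_of ht), if_neg hn]
      simp [sgnB, bwd, hn1, h, h2, ht, h0]

theorem XY_one : (lX.map gens).sum * (lY.map gens).sum = 1 := by
  refine LinearMap.ext fun f => funext fun n => ?_
  rw [Module.End.mul_apply, X_apply, Y_apply]; simp

theorem YX_ne : (lY.map gens).sum * (lX.map gens).sum ≠ 1 := by
  intro h
  have := congrFun (LinearMap.congr_fun h (fun _ => 1)) 0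
  rw [Module.End.mul_apply, Y_apply] at this
  simp at this


/-- sum of conjugates -/
def sOp {I G : Type*} [Group G] (D : I → G) (X : List I) (z : G) : G :=
  (X.map fun u => D u * z * (D u)⁻¹).prod

theorem map_sOp {I G H : Type*} [Group G] [Group H] (f : G →* H) (D : I → G) (X : List I) (z : G) :
    f (sOp D X z) = sOp (fun i => f (D i)) X (f z) := by
  simp [sOp, map_list_prod, Function.comp_def]

/-- the relations -/
structure SRels {I G : Type*} [Group G] (X Y : List I) (D : Fin 3 × I → G) (c : Fin 3 → G) :
    Prop where
  dd : ∀ k l i j, k ≠ l → D (k, i) * D (l, j) = D (l, j) * D (k, i)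
  d2p : ∀ i, D (2, i) * c 0 = c 0 * D (2, i)
  d0q : ∀ i, D (0, i) * c 1 = c 1 * D (0, i)
  d1r : ∀ i, D (1, i) * c 2 = c 2 * D (1, i)
  d12q : ∀ i, (D (1, i) * D (2, i)) * c 1 = c 1 * (D (1, i) * D (2, i))
  d02r : ∀ i, (D (0, i) * D (2, i)) * c 2 = c 2 * (D (0, i) * D (2, i))
  pq : c 0 * c 1 = c 2 * c 1 * c 0
  pr : c 0 * c 2 = c 2 * c 0
  qr : c 1 * c 2 = c 2 * c 1
  xy : sOp (fun i => D (0, i)) X (sOp (fun i => D (0, i)) Y (c 2)) = c 2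

theorem commute_lift {I G : Type*} [Group G] (D : I → G) (z : G) (h : ∀ i, Commute (D i) z)
    (w : FreeGroup I) : Commute (FreeGroup.lift D w) z := by
  induction w using FreeGroup.induction_on with
  | C1 => simp
  | of i => simpa using h i
  | inv_of i hi => simpa using hi
  | mul x y hx hy => rw [map_mul]; exact hx.mul_left hy

theorem commute_lift_mul {I G : Type*} [Group G] (D E : I → G) (z : G)
    (hDE : ∀ i j, Commute (D i) (E j))
    (h : ∀ i, Commute (D i * E i) z) (w : FreeGroup I) :
    Commute (FreeGroup.lift D w * FreeGroup.lift E w) z := by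
  have hc : ∀ v w, Commute (FreeGroup.lift D v) (FreeGroup.lift E w) := fun v w =>
    commute_lift D _ (fun i => (commute_lift E _ (fun j => (hDE i j).symm) w).symm) v
  have := commute_lift (fun i => D i * E i) z h w
  have e : FreeGroup.lift (fun i => D i * E i) =
      (MonoidHom.noncommCoprod (FreeGroup.lift D) (FreeGroup.lift E) hc).comp
        ((MonoidHom.id _).prod (MonoidHom.id _)) := by
    ext i; simp
  rw [e] at this
  simpa using this

theorem sOp_mem {I G : Type*} [Group G] (D : I → G) (V : Subgroup G)
    (hV : ∀ i, ∀ v ∈ V, D i * v * (D i)⁻¹ ∈ V) (X : List I) {v : G} (hv : v ∈ V) :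
    sOp D X v ∈ V := by
  apply Subgroup.list_prod_mem
  intro x hx
  obtain ⟨i, -, rfl⟩ := List.mem_map.1 hx
  exact hV i v hv

theorem sOp_mul {I G : Type*} [Group G] (D : I → G) (V : Subgroup G)
    (hV : ∀ i, ∀ v ∈ V, D i * v * (D i)⁻¹ ∈ V)
    (hc : ∀ v ∈ V, ∀ w ∈ V, v * w = w * v) (X : List I) {v w : G} (hv : v ∈ V) (hw : w ∈ V) :
    sOp D X (v * w) = sOp D X v * sOp D X w := by
  induction X with
  | nil => simp [sOp]
  | cons i X ih =>
    have h1 := hc _ (sOp_mem D V hV X hv) _ (hV i w hw)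
    have h2 : ∀ z, sOp D (i :: X) z = D i * z * (D i)⁻¹ * sOp D X z := fun z => by simp [sOp]
    rw [h2, h2, h2, ih]
    calc _ = (D i * v * (D i)⁻¹) * ((D i * w * (D i)⁻¹) * sOp D X v) * sOp D X w := by group
      _ = _ := by rw [← h1]; group

theorem SRels.finite {I K : Type*} [Group K] [Finite K] {X Y : List I} {D : Fin 3 × I → K}
    {c : Fin 3 → K} (h : SRels X Y D c) :
    sOp (fun i => D (0, i)) Y (sOp (fun i => D (0, i)) X (c 2)) = c 2 := by
  set p := c 0
  set q := c 1
  set r := c 2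
  let E : Fin 3 → FreeGroup I →* K := fun k => FreeGroup.lift fun i => D (k, i)
  have hE : ∀ k l, k ≠ l → ∀ s t, Commute (E k s) (E l t) := fun k l hkl s t =>
    commute_lift _ _ (fun i => (commute_lift _ _ (fun j => h.dd l k j i hkl.symm) t).symm) s
  have h2p : ∀ t, Commute (E 2 t) p := commute_lift _ _ h.d2p
  have h0q : ∀ t, Commute (E 0 t) q := commute_lift _ _ h.d0q
  have h1r : ∀ t, Commute (E 1 t) r := commute_lift _ _ h.d1r
  have h12q : ∀ t, Commute (E 1 t * E 2 t) q :=
    commute_lift_mul _ _ _ (fun i j => h.dd 1 2 i j (by decide)) h.d12q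
  have h02r : ∀ t, Commute (E 0 t * E 2 t) r :=
    commute_lift_mul _ _ _ (fun i j => h.dd 0 2 i j (by decide)) h.d02r
  let C : FreeGroup I → K := fun t => E 2 t * r * (E 2 t)⁻¹
  have hC0 : ∀ t, C t = (E 0 t)⁻¹ * r * E 0 t := by
    intro t
    have h1 : E 0 t * E 2 t * r = r * (E 0 t * E 2 t) := h02r t
    have h2 : E 0 t * E 2 t = E 2 t * E 0 t := hE 0 2 (by decide) t t
    simp only [C]
    rw [mul_inv_eq_iff_eq_mul]
    calc E 2 t * r = (E 0 t)⁻¹ * (E 0 t * E 2 t * r) := by group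
      _ = _ := by rw [h1]; group
  have hQ : ∀ t, E 2 t * q * (E 2 t)⁻¹ = (E 1 t)⁻¹ * q * E 1 t := by
    intro t
    have h1 : E 1 t * E 2 t * q = q * (E 1 t * E 2 t) := h12q t
    rw [mul_inv_eq_iff_eq_mul]
    calc E 2 t * q = (E 1 t)⁻¹ * (E 1 t * E 2 t * q) := by group
      _ = _ := by rw [h1]; group
  have hCp : ∀ t, Commute (C t) p := fun t =>
    ((h2p t).mul_left (Commute.symm h.pr)).mul_left (h2p t).inv_left
  have hCq : ∀ s t, Commute (C s) (E 2 t * q * (E 2 t)⁻¹) := by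
    intro s t
    have h1 : Commute (C s) (E 1 t) := by
      rw [hC0]
      have := hE 0 1 (by decide) s t
      exact (this.inv_left.mul_left (h1r t).symm).mul_left this
    have h2 : Commute (C s) q := by
      rw [hC0]
      exact ((h0q s).inv_left.mul_left (Commute.symm h.qr)).mul_left (h0q s)
    rw [hQ]
    exact (h1.inv_right.mul_right h2).mul_right h1
  have hCC : ∀ s t, Commute (C s) (C t) := by
    intro s t
    have hr : r = p * q * p⁻¹ * q⁻¹ := by
      have := h.pq
      rw [eq_mul_inv_iff_mul_eq, eq_mul_inv_iff_mul_eq]; exact this.symm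
    have h1 : E 2 t * p = p * E 2 t := h2p t
    have h1' : p⁻¹ = (E 2 t)⁻¹ * p⁻¹ * E 2 t := by
      rw [eq_comm, mul_assoc, inv_mul_eq_iff_eq_mul]; exact ((h2p t).inv_right.eq).symm
    have e : C t = p * (E 2 t * q * (E 2 t)⁻¹) * p⁻¹ * (E 2 t * q * (E 2 t)⁻¹)⁻¹ := by
      simp only [C]
      rw [hr]
      calc _ = (E 2 t * p) * q * p⁻¹ * q⁻¹ * (E 2 t)⁻¹ := by group
        _ = p * E 2 t * q * ((E 2 t)⁻¹ * p⁻¹ * E 2 t) * q⁻¹ * (E 2 t)⁻¹ := by rw [h1, ← h1']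
        _ = _ := by group
    rw [e]
    exact (((hCp s).mul_right (hCq s t)).mul_right (hCp s).inv_right).mul_right
      (hCq s t).inv_right
  let V : Subgroup K := Subgroup.closure (Set.range C)
  have hVc : ∀ v ∈ V, ∀ w ∈ V, v * w = w * v := by
    intro v hv w hw
    have := Subgroup.isMulCommutative_closure (k := Set.range C) (by
      rintro _ ⟨s, rfl⟩ _ ⟨t, rfl⟩; exact hCC s t)
    exact setLike_mul_comm hv hw
  have hVn : ∀ i, ∀ v ∈ V, D (0, i) * v * (D (0, i))⁻¹ ∈ V := by
    intro i v hv
    induction hv using Subgroup.closure_induction with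
    | mem x hx =>
      obtain ⟨t, rfl⟩ := hx
      apply Subgroup.subset_closure
      refine ⟨t * (FreeGroup.of i)⁻¹, ?_⟩
      rw [hC0, hC0, map_mul, map_inv]
      have : E 0 (FreeGroup.of i) = D (0, i) := FreeGroup.lift_apply_of
      rw [this]; group
    | one => simp
    | mul x y _ _ hx hy => have := V.mul_mem hx hy; simpa [mul_assoc] using this
    | inv x _ hx => have := V.inv_mem hx; simpa [mul_assoc] using this
  set D0 : I → K := fun i => D (0, i) with hD0
  have hid : ∀ v ∈ V, sOp D0 X (sOp D0 Y v) = v := by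
    intro v hv
    have h1 : sOp D0 X (sOp D0 Y 1) = 1 := by simp [sOp]
    induction hv using Subgroup.closure_induction with
    | mem x hx =>
      obtain ⟨t, rfl⟩ := hx
      have hconj : (fun i => MulAut.conj (E 2 t) (D0 i)) = D0 := by
        funext i
        have := hE 2 0 (by decide) t (FreeGroup.of i)
        have e : E 0 (FreeGroup.of i) = D0 i := FreeGroup.lift_apply_of
        rw [e] at this
        rw [MulAut.conj_apply, this.eq]; simp
      have h2 := congrArg (MulAut.conj (E 2 t)).toMonoidHom h.xy
      rw [map_sOp, map_sOp] at h2
      simp only [MulEquiv.toMonoidHom_eq_coe, MonoidHom.coe_coe] at h2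
      simp only [D0] at hconj
      rw [hconj, MulAut.conj_apply] at h2
      exact h2
    | one => exact h1
    | mul x y hx hy h3 h4 =>
      rw [sOp_mul D0 V hVn hVc Y hx hy, sOp_mul D0 V hVn hVc X (sOp_mem D0 V hVn Y hx)
        (sOp_mem D0 V hVn Y hy), h3, h4]
    | inv x hx h3 =>
      have hx' := V.inv_mem hx
      have := sOp_mul D0 V hVn hVc X (sOp_mem D0 V hVn Y hx) (sOp_mem D0 V hVn Y hx')
      rw [← sOp_mul D0 V hVn hVc Y hx hx', h3, mul_inv_cancel, h1] at this
      rw [eq_comm, inv_eq_iff_mul_eq_one]; exact this.symm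
  have hr : r ∈ V := Subgroup.subset_closure ⟨1, by simp [C]⟩
  let yh : V → V := fun v => ⟨sOp D0 Y v, sOp_mem D0 V hVn Y v.2⟩
  have hinj : Function.Injective yh := by
    intro v w hvw
    have := congrArg (fun z : V => sOp D0 X z) hvw
    simp only [yh] at this
    rw [hid v v.2, hid w w.2] at this
    exact Subtype.ext this
  obtain ⟨v, hv⟩ := (Finite.injective_iff_surjective.1 hinj) ⟨r, hr⟩
  have hv' : sOp D0 Y v = r := congrArg Subtype.val hv
  have : sOp D0 X r = v := by rw [← hv']; exact hid v v.2
  rw [this, hv']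

/-- finitely many relators encode the relations -/
theorem exists_relators {I : Type} [Finite I] (X Y : List I) :
    ∃ S : Set (FreeGroup ((Fin 3 × I) ⊕ Fin 3)), S.Finite ∧
      ∀ (G : Type) [Group G] (x : (Fin 3 × I) ⊕ Fin 3 → G),
        (∀ w ∈ S, FreeGroup.lift x w = 1) ↔
          SRels X Y (fun a => x (Sum.inl a)) (fun a => x (Sum.inr a)) := by
  let d : Fin 3 → I → FreeGroup ((Fin 3 × I) ⊕ Fin 3) := fun k i => FreeGroup.of (Sum.inl (k, i))
  let c : Fin 3 → FreeGroup ((Fin 3 × I) ⊕ Fin 3) := fun k => FreeGroup.of (Sum.inr k)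
  let S1 := Set.range fun a : {k : Fin 3 × Fin 3 // k.1 ≠ k.2} × I × I =>
    d a.1.1.1 a.2.1 * d a.1.1.2 a.2.2 * (d a.1.1.2 a.2.2 * d a.1.1.1 a.2.1)⁻¹
  let S2 := Set.range fun i => d 2 i * c 0 * (c 0 * d 2 i)⁻¹
  let S3 := Set.range fun i => d 0 i * c 1 * (c 1 * d 0 i)⁻¹
  let S4 := Set.range fun i => d 1 i * c 2 * (c 2 * d 1 i)⁻¹
  let S5 := Set.range fun i => (d 1 i * d 2 i) * c 1 * (c 1 * (d 1 i * d 2 i))⁻¹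
  let S6 := Set.range fun i => (d 0 i * d 2 i) * c 2 * (c 2 * (d 0 i * d 2 i))⁻¹
  let S7 : Set (FreeGroup ((Fin 3 × I) ⊕ Fin 3)) :=
    {c 0 * c 1 * (c 2 * c 1 * c 0)⁻¹, c 0 * c 2 * (c 2 * c 0)⁻¹, c 1 * c 2 * (c 2 * c 1)⁻¹,
      sOp (d 0) X (sOp (d 0) Y (c 2)) * (c 2)⁻¹}
  refine ⟨S1 ∪ S2 ∪ S3 ∪ S4 ∪ S5 ∪ S6 ∪ S7, ?_, ?_⟩
  · have hf : ∀ {J : Type} [Finite J] (f : J → FreeGroup ((Fin 3 × I) ⊕ Fin 3)),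
      (Set.range f).Finite := fun f => Set.finite_range f
    exact ((((((hf _).union (hf _)).union (hf _)).union (hf _)).union (hf _)).union (hf _)).union
      (Set.toFinite _)
  · intro G _ x
    have hd : ∀ k i, FreeGroup.lift x (d k i) = x (Sum.inl (k, i)) := fun k i => by simp [d]
    have hc : ∀ k, FreeGroup.lift x (c k) = x (Sum.inr k) := fun k => by simp [c]
    have hu : ∀ (A B : Set (FreeGroup ((Fin 3 × I) ⊕ Fin 3))),
        (∀ w ∈ A ∪ B, FreeGroup.lift x w = 1) ↔
          (∀ w ∈ A, FreeGroup.lift x w = 1) ∧ (∀ w ∈ B, FreeGroup.lift x w = 1) := by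
      intro A B; simp only [Set.mem_union, or_imp, forall_and]
    simp only [hu, S1, S2, S3, S4, S5, S6, S7, Set.forall_mem_range, Set.mem_insert_iff,
      Set.mem_singleton_iff, forall_eq_or_imp, forall_eq, map_mul, map_inv,
      hd, hc, map_sOp]
    simp only [mul_inv_eq_one]
    constructor
    · rintro ⟨⟨⟨⟨⟨⟨h1, h2⟩, h3⟩, h4⟩, h5⟩, h6⟩, h7, h8, h9, h10⟩
      exact ⟨fun k l i j hkl => h1 ⟨⟨(k, l), hkl⟩, i, j⟩, h2, h3, h4, h5, h6, h7, h8, h9, h10⟩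
    · rintro ⟨h1, h2, h3, h4, h5, h6, h7, h8, h9, h10⟩
      exact ⟨⟨⟨⟨⟨⟨fun a => h1 _ _ _ _ a.1.2, h2⟩, h3⟩, h4⟩, h5⟩, h6⟩, h7, h8, h9, h10⟩

theorem separation_of_rels {I : Type} [Finite I] (X Y : List I) (H : Type) [inst : Group H]
    (hH : IsMulTorsion H) (D : Fin 3 × I → H) (c : Fin 3 → H) (h : SRels X Y D c)
    (hW : sOp (fun i => D (0, i)) Y (sOp (fun i => D (0, i)) X (c 2)) ≠ c 2) :
    ∃ (s t : ℕ) (R : Fin t → FreeGroup (Fin s)) (W : FreeGroup (Fin s)),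
      (∀ (K : Type) [Group K] [Finite K] (x : Fin s → K),
        (∀ j, FreeGroup.lift x (R j) = 1) → FreeGroup.lift x W = 1) ∧
      ∃ (H : Type) (inst : Group H), letI := inst;
        IsMulTorsion H ∧
          ∃ x : Fin s → H,
            (∀ j, FreeGroup.lift x (R j) = 1) ∧ FreeGroup.lift x W ≠ 1 := by
  obtain ⟨S, hS, hR⟩ := exists_relators X Y
  obtain ⟨s, ⟨e⟩⟩ := Finite.exists_equiv_fin ((Fin 3 × I) ⊕ Fin 3)
  have : Finite S := hS
  obtain ⟨t, ⟨f⟩⟩ := Finite.exists_equiv_fin S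
  have hl : ∀ (G : Type) [Group G] (x : Fin s → G) (w : FreeGroup ((Fin 3 × I) ⊕ Fin 3)),
      FreeGroup.lift x (FreeGroup.map e w) = FreeGroup.lift (x ∘ e) w := by
    intro G _ x w
    induction w using FreeGroup.induction_on with
    | C1 => simp
    | of i => simp
    | inv_of i hi => simp
    | mul a b ha hb => simp only [map_mul, ha, hb]
  let W : FreeGroup ((Fin 3 × I) ⊕ Fin 3) :=
    sOp (fun i => FreeGroup.of (Sum.inl (0, i))) Y
      (sOp (fun i => FreeGroup.of (Sum.inl (0, i))) X (FreeGroup.of (Sum.inr 2))) *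
        (FreeGroup.of (Sum.inr 2))⁻¹
  have hWl : ∀ (G : Type) [Group G] (x : (Fin 3 × I) ⊕ Fin 3 → G),
      FreeGroup.lift x W = sOp (fun i => x (Sum.inl (0, i))) Y
        (sOp (fun i => x (Sum.inl (0, i))) X (x (Sum.inr 2))) * (x (Sum.inr 2))⁻¹ := by
    intro G _ x
    simp only [W, map_mul, map_inv, map_sOp, FreeGroup.lift_apply_of]
  refine ⟨s, t, fun j => FreeGroup.map e (f.symm j), FreeGroup.map e W, ?_, H, inst, hH, ?_⟩
  · intro K _ _ x hx
    simp only [hl] at hx ⊢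
    have h1 := (hR K (x ∘ e)).1 (fun w hw => by simpa using hx (f ⟨w, hw⟩))
    rw [hWl, mul_inv_eq_one]
    exact h1.finite
  · refine ⟨Sum.elim D c ∘ e.symm, ?_, ?_⟩
    · intro j
      rw [hl]
      refine (hR H _).2 ?_ _ (f.symm j).2
      simpa [Function.comp_def] using h
    · rw [hl, hWl, Ne, mul_inv_eq_one]
      simpa [Function.comp_def] using hW

theorem sOp_cons {I G : Type*} [Group G] (D : I → G) (i : I) (X : List I) (z : G) :
    sOp D (i :: X) z = D i * z * (D i)⁻¹ * sOp D X z := by simp [sOp]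

/-- upper triangular matrices with diagonal in the torsion monoid -/
def uSub : Submonoid (Matrix (Fin 3) (Fin 3) MonR) where
  carrier := {M | M 1 0 = 0 ∧ M 2 0 = 0 ∧ M 2 1 = 0 ∧ ∀ i, M i i ∈ monSub}
  one_mem' := ⟨by simp, by simp, by simp, fun i => by simpa using monSub.one_mem⟩
  mul_mem' := by
    rintro A B ⟨a1, a2, a3, a4⟩ ⟨b1, b2, b3, b4⟩
    refine ⟨?_, ?_, ?_, ?_⟩
    · simp [Matrix.mul_apply, Fin.sum_univ_three, a1, b1, b2]
    · simp [Matrix.mul_apply, Fin.sum_univ_three, a2, a3, b1, b2]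
    · simp [Matrix.mul_apply, Fin.sum_univ_three, a2, a3, b3]
    · intro i
      have := monSub.mul_mem (a4 i) (b4 i)
      fin_cases i <;>
        simpa [Matrix.mul_apply, Fin.sum_univ_three, a1, a2, a3, b1, b2, b3] using this

theorem three_MonR : (3 : MonR) = 0 := by
  refine LinearMap.ext fun f => funext fun n => ?_
  have h3 : (3 : ZMod 3) = 0 := by decide
  have : (3 : MonR) = 1 + 1 + 1 := by norm_num
  rw [this]
  simp only [LinearMap.add_apply, Module.End.one_apply, Pi.add_apply, LinearMap.zero_apply,
    Pi.zero_apply]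
  linear_combination f n * h3

theorem uSub_pow_diag {M} (hM : M ∈ uSub) (k : ℕ) (i : Fin 3) : (M ^ k) i i = (M i i) ^ k := by
  induction k with
  | zero => simp
  | succ k ih =>
    obtain ⟨a1, a2, a3, a4⟩ := hM
    obtain ⟨b1, b2, b3, b4⟩ := uSub.pow_mem (show M ∈ uSub from ⟨a1, a2, a3, a4⟩) k
    rw [pow_succ, pow_succ, ← ih, Matrix.mul_apply, Fin.sum_univ_three]
    fin_cases i <;> simp [a1, a2, a3, b1, b2, b3]

theorem cube_one {R : Type*} [Ring R] (h3 : ∀ x : R, x + x + x = 0) (P : Matrix (Fin 3) (Fin 3) R)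
    (b1 : P 1 0 = 0) (b2 : P 2 0 = 0) (b3 : P 2 1 = 0) (d0 : P 0 0 = 1) (d1 : P 1 1 = 1)
    (d2 : P 2 2 = 1) : P ^ 3 = 1 := by
  rw [pow_succ, pow_two]
  ext i j
  fin_cases i <;> fin_cases j <;>
    simp [Matrix.mul_apply, Fin.sum_univ_three, b1, b2, b3, d0, d1, d2]
  · refine Eq.trans ?_ (h3 (P 0 1))
    abel
  · have h4 := h3 (P 0 2 + P 0 1 * P 1 2)
    refine Eq.trans ?_ h4
    noncomm_ring
  · refine Eq.trans ?_ (h3 (P 1 2))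
    abel

theorem uSub_fin {M} (hM : M ∈ uSub) : IsOfFinOrder M := by
  have h : ∀ i, ∃ n, 0 < n ∧ (M i i) ^ n = 1 := fun i =>
    isOfFinOrder_iff_pow_eq_one.1 (monSub_fin (hM.2.2.2 i))
  choose n hn hp using h
  let N := n 0 * n 1 * n 2
  have hN : 0 < N := by have := hn 0; have := hn 1; have := hn 2; positivity
  have hd : ∀ i, (M ^ N) i i = 1 := by
    intro i
    have : n i ∣ N := by
      fin_cases i
      · exact (Dvd.intro _ rfl).mul_right _
      · exact (Dvd.intro_left _ rfl).mul_right _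
      · exact Dvd.intro_left _ rfl
    obtain ⟨m, hm⟩ := this
    rw [uSub_pow_diag hM, hm, pow_mul, hp, one_pow]
  obtain ⟨b1, b2, b3, -⟩ := uSub.pow_mem hM N
  rw [isOfFinOrder_iff_pow_eq_one]
  refine ⟨N * 3, by omega, ?_⟩
  rw [pow_mul]
  set P := M ^ N
  have d0 := hd 0
  have d1 := hd 1
  have d2 := hd 2
  have h3 : ∀ x : MonR, x + x + x = 0 := fun x => by
    have : x + x + x = 3 * x := by noncomm_ring
    rw [this, three_MonR, zero_mul]
  exact cube_one h3 P b1 b2 b3 d0 d1 d2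

theorem uSub_torsion : IsMulTorsion uSub := by
  intro M
  exact (Submonoid.isOfFinOrder_coe).1 (uSub_fin M.2)

noncomputable instance uGroup : Group uSub := uSub_torsion.group

/-- elementary matrix group -/
def eU (x : MonR) : uSub := ⟨!![1, 0, x; 0, 1, 0; 0, 0, 1], by
  refine ⟨rfl, rfl, rfl, fun i => ?_⟩
  fin_cases i <;> exact monSub.one_mem⟩

/-- first elementary -/
def pU : uSub := ⟨!![1, 1, 0; 0, 1, 0; 0, 0, 1], by
  refine ⟨rfl, rfl, rfl, fun i => ?_⟩
  fin_cases i <;> exact monSub.one_mem⟩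

/-- second elementary -/
def qU : uSub := ⟨!![1, 0, 0; 0, 1, 1; 0, 0, 1], by
  refine ⟨rfl, rfl, rfl, fun i => ?_⟩
  fin_cases i <;> exact monSub.one_mem⟩

/-- diagonal elements -/
noncomputable def dU (a : Fin 3 × (Fin 3 × Fin 3)) : uSub :=
  ⟨Matrix.diagonal (Function.update 1 a.1 (gens a.2)), by
  refine ⟨rfl, rfl, rfl, fun i => ?_⟩
  rw [Matrix.diagonal_apply_eq, Function.update_apply]
  split_ifs
  · exact gens_mem _
  · exact monSub.one_mem⟩

theorem uMul (A B : uSub) : ((A * B : uSub) : Matrix (Fin 3) (Fin 3) MonR) = A.1 * B.1 := rfl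

theorem eU_mul (x y) : eU x * eU y = eU (x + y) := by
  refine Subtype.ext ?_
  rw [uMul]
  simp only [eU]
  ext i j : 2
  fin_cases i <;> fin_cases j <;> simp [Matrix.mul_apply, Fin.sum_univ_three, add_comm]

theorem eU_zero : eU 0 = 1 := by
  refine Subtype.ext ?_
  show _ = (1 : Matrix (Fin 3) (Fin 3) MonR)
  simp only [eU]
  ext i j : 2
  fin_cases i <;> fin_cases j <;> simp

theorem dU_eU (i x) : dU (0, i) * eU x = eU (gens i * x) * dU (0, i) := by
  refine Subtype.ext ?_
  rw [uMul, uMul]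
  simp only [eU, dU]
  ext i j : 2
  fin_cases i <;> fin_cases j <;> simp [Matrix.mul_apply, Fin.sum_univ_three]

theorem sOp_eU (X : List (Fin 3 × Fin 3)) (x : MonR) :
    sOp (fun i => dU (0, i)) X (eU x) = eU ((X.map gens).sum * x) := by
  induction X with
  | nil => simp [sOp, eU_zero]
  | cons i X ih =>
    rw [sOp_cons, ih, dU_eU, mul_inv_cancel_right, eU_mul, List.map_cons, List.sum_cons, add_mul]

theorem eU_inj {x y} (h : eU x = eU y) : x = y := by
  have := congrFun (congrFun (congrArg Subtype.val h) 0) 2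
  simpa [eU] using this

theorem uRels : SRels lX lY dU ![pU, qU, eU 1] where
  dd k l i j hkl := by
    refine Subtype.ext ?_
    rw [uMul, uMul]
    simp only [dU, Matrix.diagonal_mul_diagonal]
    congr 1
    funext m
    by_cases h1 : m = k
    · subst h1; simp [Function.update_apply, hkl]
    · simp [Function.update_apply, h1]
  d2p i := by
    refine Subtype.ext ?_
    rw [uMul, uMul]
    simp only [dU]
    ext i j : 2
    fin_cases i <;> fin_cases j <;> simp [pU, Matrix.mul_apply, Fin.sum_univ_three]
  d0q i := by
    refine Subtype.ext ?_
    rw [uMul, uMul]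
    simp only [dU]
    ext i j : 2
    fin_cases i <;> fin_cases j <;> simp [qU, Matrix.mul_apply, Fin.sum_univ_three]
  d1r i := by
    refine Subtype.ext ?_
    rw [uMul, uMul]
    simp only [dU]
    ext i j : 2
    fin_cases i <;> fin_cases j <;> simp [eU, Matrix.mul_apply, Fin.sum_univ_three]
  d12q i := by
    refine Subtype.ext ?_
    simp only [uMul]
    simp only [dU]
    ext i j : 2
    fin_cases i <;> fin_cases j <;> simp [qU, Matrix.mul_apply, Fin.sum_univ_three]
  d02r i := by
    refine Subtype.ext ?_
    simp only [uMul]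
    simp only [dU]
    ext i j : 2
    fin_cases i <;> fin_cases j <;> simp [eU, Matrix.mul_apply, Fin.sum_univ_three]
  pq := by
    refine Subtype.ext ?_
    simp only [uMul]
    ext i j : 2
    fin_cases i <;> fin_cases j <;> simp [pU, qU, eU, Matrix.mul_apply, Fin.sum_univ_three]
  pr := by
    refine Subtype.ext ?_
    simp only [uMul]
    ext i j : 2
    fin_cases i <;> fin_cases j <;> simp [pU, eU, Matrix.mul_apply, Fin.sum_univ_three]
  qr := by
    refine Subtype.ext ?_
    simp only [uMul]
    ext i j : 2
    fin_cases i <;> fin_cases j <;> simp [qU, eU, Matrix.mul_apply, Fin.sum_univ_three]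
  xy := by
    show sOp _ lX (sOp _ lY (eU 1)) = eU 1
    rw [sOp_eU, sOp_eU, ← mul_assoc, XY_one, one_mul]

theorem uW : sOp (fun i => dU (0, i)) lY (sOp (fun i => dU (0, i)) lX (eU 1)) ≠ eU 1 := by
  rw [sOp_eU, sOp_eU, mul_one]
  exact fun h => YX_ne (eU_inj h)

/-- There are finitely many relators `R` and a word `W` in a free group such that every
finite group satisfying the relations satisfies `W = 1`, while some torsion group
satisfies the relations but not `W = 1`. -/
theorem exists_relators_word_finite_torsion_separation :
    ∃ (s t : ℕ) (R : Fin t → FreeGroup (Fin s)) (W : FreeGroup (Fin s)),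
      (∀ (K : Type) [Group K] [Finite K] (x : Fin s → K),
        (∀ j, FreeGroup.lift x (R j) = 1) → FreeGroup.lift x W = 1) ∧
      ∃ (H : Type) (inst : Group H), letI := inst;
        Monoid.IsTorsion H ∧
          ∃ x : Fin s → H,
            (∀ j, FreeGroup.lift x (R j) = 1) ∧ FreeGroup.lift x W ≠ 1 := by
  exact separation_of_rels lX lY uSub uSub_torsion dU _ uRels uW
end

section
/- The universal theory of the class of torsion groups is undecidable: with respect to a fixed effective encoding of L_grp-sentences as natural numbers, there is no computable function deciding, for a given universal sentence, whether it holds in every torsion group. -/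
open FirstOrder

/-- A fixed effective encoding of the symbols of `grpLang`. -/
instance grpFunEncodable (n : ℕ) : Encodable (grpLang.Functions n) :=
  match n with
  | 0 => inferInstanceAs (Encodable Unit)
  | 1 => inferInstanceAs (Encodable Unit)
  | 2 => inferInstanceAs (Encodable Unit)
  | _ + 3 => inferInstanceAs (Encodable Empty)

instance grpRelEncodable (n : ℕ) : Encodable (grpLang.Relations n) :=
  inferInstanceAs (Encodable Empty)

/-- The fixed effective encoding of first-order formulas of `grpLang` (via Mathlib's
list encoding of bounded formulas). -/
instance grpSigmaBFEncodable : Encodable (Σ n, grpLang.BoundedFormula Empty n) :=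
  Encodable.ofLeftInjection
    (fun φ => φ.2.listEncode)
    (fun l => (FirstOrder.Language.BoundedFormula.listDecode l)[0]?)
    (fun φ => FirstOrder.Language.BoundedFormula.encoding.decode_encode φ)

/-- The fixed effective encoding of `grpLang`-sentences as natural numbers. -/
instance grpSentenceEncodable : Encodable grpLang.Sentence :=
  Encodable.ofLeftInjection
    (fun φ => (⟨0, φ⟩ : Σ n, grpLang.BoundedFormula Empty n))
    (fun ψ => match ψ with | ⟨0, φ⟩ => some φ | _ => none)
    (fun _ => rfl)

namespace TorsionUndec
open Turing

set_option linter.unusedSectionVars false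


instance fintypeStacks : Fintype PartrecToTM2.K' :=
  ⟨{.main, .rev, .aux, .stack}, fun x => by cases x <;> decide⟩

theorem trNat_two_pow (m : ℕ) :
    PartrecToTM2.trNat (2 ^ m) =
      List.replicate m PartrecToTM2.Γ'.bit0 ++ [PartrecToTM2.Γ'.bit1] := by
  suffices h : ∃ p : PosNum, ((2 ^ m : ℕ) : Num) = Num.pos p ∧ PartrecToTM2.trPosNum p =
      List.replicate m PartrecToTM2.Γ'.bit0 ++ [PartrecToTM2.Γ'.bit1] by
    obtain ⟨p, h1, h2⟩ := h
    rw [PartrecToTM2.trNat, h1, PartrecToTM2.trNum, h2]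
  induction m with
  | zero => exact ⟨PosNum.one, rfl, rfl⟩
  | succ m ih =>
    obtain ⟨p, h1, h2⟩ := ih
    refine ⟨PosNum.bit0 p, ?_, ?_⟩
    · have : ((2 ^ (m + 1) : ℕ) : Num) = Num.bit0 (2 ^ m : ℕ) := by
        rw [pow_succ, mul_two, Nat.cast_add, Num.bit0_of_bit0]
      rw [this, h1]; rfl
    · simp [PartrecToTM2.trPosNum, h2, List.replicate_succ]

theorem exists_tm0 (f : ℕ →. ℕ) (hf : Partrec f) :
    ∃ (Γ Λ : Type) (_ : Finite Γ) (_ : Inhabited Γ) (_ : Inhabited Λ)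
      (M : TM0.Machine Γ Λ) (S : Set Λ) (P : Γ → Prop) (x : List Γ) (a : Γ),
      S.Finite ∧ TM0.Supports M S ∧ ∀ m : ℕ,
        (0 ∈ f (2 ^ m) → ∃ c, c ∈ StateTransition.eval (TM0.step M)
          (TM0.init (x ++ List.replicate m a)) ∧ ¬ P c.Tape.head) ∧
        (1 ∈ f (2 ^ m) → ∃ c, c ∈ StateTransition.eval (TM0.step M)
          (TM0.init (x ++ List.replicate m a)) ∧ P c.Tape.head) := by
  classical
  obtain ⟨c, hc⟩ := ToPartrec.Code.exists_code (n := 1) (f := fun v => f v.head)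
    (Nat.Partrec'.part_iff₁.2 hf)
  let c' := ToPartrec.Code.comp (ToPartrec.Code.case ToPartrec.Code.tail ToPartrec.Code.zero') c
  have hc' : ∀ k b, b ∈ f k → c'.eval [k] =
      Part.some (if b = 0 then [] else [0, b - 1]) := by
    intro k b hb
    have h1 : c.eval [k] = pure <$> f k := hc ⟨[k], rfl⟩
    rw [Part.eq_some_iff.2 hb] at h1
    have h2 : c.eval [k] = Part.some [b] := by rw [h1]; simp [Part.map_eq_map]
    simp only [c', ToPartrec.Code.comp_eval, h2, Part.bind_eq_bind, Part.bind_some,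
      ToPartrec.Code.case_eval, ToPartrec.Code.tail_eval, ToPartrec.Code.zero'_eval]
    cases b <;> simp [Part.pure_eq_some]
  let _ : Inhabited PartrecToTM2.Λ' := ⟨PartrecToTM2.trNormal c' PartrecToTM2.Cont'.halt⟩
  let M2 := PartrecToTM2.tr
  have hs2 : TM2.Supports M2 (PartrecToTM2.codeSupp c' PartrecToTM2.Cont'.halt) :=
    PartrecToTM2.tr_supports c' PartrecToTM2.Cont'.halt
  have hs1 := TM2to1.tr_supports M2 hs2
  have hs0 := TM1to0.tr_supports (TM2to1.tr M2) hs1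
  let cell : PartrecToTM2.Γ' → TM2to1.Γ' PartrecToTM2.K' (fun _ => PartrecToTM2.Γ') :=
    fun a => (false, Function.update (fun _ => none) PartrecToTM2.K'.main (some a))
  let bot : TM2to1.Γ' PartrecToTM2.K' (fun _ => PartrecToTM2.Γ') :=
    (true, Function.update (fun _ => none) PartrecToTM2.K'.main (some .cons))
  have key : ∀ m b, b ∈ f (2 ^ m) → ∃ c, c ∈ StateTransition.eval
      (TM0.step (TM1to0.tr (TM2to1.tr M2)))
      (TM0.init ([bot, cell .bit1] ++ List.replicate m (cell .bit0))) ∧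
      (c.Tape.head.2 PartrecToTM2.K'.main ≠ none ↔ b ≠ 0) := by
    intro m b hb
    have hinit : TM2to1.trInit (Γ := fun _ => PartrecToTM2.Γ') PartrecToTM2.K'.main
        (PartrecToTM2.trList [2 ^ m]) =
        [bot, cell .bit1] ++ List.replicate m (cell .bit0) := by
      simp [TM2to1.trInit, trNat_two_pow, cell, bot]
      erw [List.map_cons, List.map_cons, List.map_replicate]
      rfl
    have h2 := PartrecToTM2.tr_eval c' [2 ^ m]
    rw [hc' _ _ hb] at h2
    have hi : PartrecToTM2.init c' [2 ^ m] =
        TM2.init PartrecToTM2.K'.main (PartrecToTM2.trList [2 ^ m]) := by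
      simp only [PartrecToTM2.init, TM2.init]
      congr 1
      funext k
      cases k <;> simp [Function.update]
    rw [hi] at h2
    have h3 : PartrecToTM2.trList (if b = 0 then [] else [0, b - 1]) ∈
        TM2.eval M2 PartrecToTM2.K'.main (PartrecToTM2.trList [2 ^ m]) := by
      refine (Part.mem_map_iff _).2 ⟨PartrecToTM2.halt (if b = 0 then [] else [0, b - 1]), ?_, rfl⟩
      erw [h2]
      simp
      exact Part.mem_some _
    obtain ⟨L₁, hL₁⟩ := Part.dom_iff_mem.1 ((TM2to1.tr_eval_dom M2 _ _).2
      (Part.dom_iff_mem.2 ⟨_, h3⟩))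
    obtain ⟨S, L', e1, e2, e3⟩ := TM2to1.tr_eval M2 _ _ hL₁ h3
    rw [← TM1to0.tr_eval, hinit, TM0.eval, Part.mem_map_iff] at hL₁
    obtain ⟨c0, hc0, hc1⟩ := hL₁
    refine ⟨c0, hc0, ?_⟩
    have hh : c0.Tape.head = L₁.head := by rw [← hc1]; simp [Tape.right₀]
    have hv := TM2to1.stk_nth_val (Γ := fun _ => PartrecToTM2.Γ')
      (k := PartrecToTM2.K'.main) (S := S PartrecToTM2.K'.main) 0
      (e2 PartrecToTM2.K'.main)
    have : c0.Tape.head.2 = L'.nth 0 := by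
      rw [hh, ← e1, ← TM2to1.addBottom_nth_snd, ListBlank.nth_zero]
    rw [this, hv, e3]
    by_cases h0 : b = 0 <;> simp [h0]
  refine ⟨TM2to1.Γ' PartrecToTM2.K' (fun _ => PartrecToTM2.Γ'), TM1to0.Λ' (TM2to1.tr M2),
    inferInstanceAs (Finite (Bool × (PartrecToTM2.K' → Option PartrecToTM2.Γ'))),
    inferInstance, inferInstance, TM1to0.tr (TM2to1.tr M2), _,
    fun a => a.2 PartrecToTM2.K'.main ≠ none, [bot, cell .bit1], cell .bit0,
    Finset.finite_toSet _, hs0, fun m => ⟨?_, ?_⟩⟩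
  · intro h
    obtain ⟨c, h1, h2⟩ := key m _ h
    exact ⟨c, h1, fun h => h2.1 h rfl⟩
  · intro h
    obtain ⟨c, h1, h2⟩ := key m _ h
    exact ⟨c, h1, h2.2 one_ne_zero⟩


section Rewriting

variable {Γ Λ : Type} [Inhabited Γ] [Inhabited Λ] (M : TM0.Machine Γ Λ) (S : Set Λ) (P : Γ → Prop)

/-- Configurations: reversed left part, state, right part. -/
abbrev RCfg (Γ Λ : Type) (S : Set Λ) : Type :=
  List (Option Γ) × Option S × List (Option Γ)

/-- The string rewriting steps simulating a Turing machine. -/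
inductive RStep : RCfg Γ Λ S → RCfg Γ Λ S → Prop
  | write (p r : List (Option Γ)) (q q' : S) (a b : Γ)
      (h : M q.1 a = some (q'.1, TM0.Stmt.write b)) :
      RStep (p, some q, some a :: r) (p, some q', some b :: r)
  | right (p r : List (Option Γ)) (q q' : S) (a : Γ)
      (h : M q.1 a = some (q'.1, TM0.Stmt.move Dir.right)) :
      RStep (p, some q, some a :: r) (some a :: p, some q', r)
  | left (p r : List (Option Γ)) (q q' : S) (a c : Γ)
      (h : M q.1 a = some (q'.1, TM0.Stmt.move Dir.left)) :
      RStep (some c :: p, some q, some a :: r) (p, some q', some c :: some a :: r)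
  | left0 (p r : List (Option Γ)) (q q' : S) (a : Γ)
      (h : M q.1 a = some (q'.1, TM0.Stmt.move Dir.left)) :
      RStep (none :: p, some q, some a :: r) (none :: p, some q', some default :: some a :: r)
  | ext (p r : List (Option Γ)) (q : S) :
      RStep (p, some q, none :: r) (p, some q, some default :: none :: r)
  | halt (p r : List (Option Γ)) (q : S) (a : Γ) (h : M q.1 a = none) (h' : P a) :
      RStep (p, some q, some a :: r) (p, none, r)
  | eraseR (p r : List (Option Γ)) (x : Option Γ) : RStep (p, none, x :: r) (p, none, r)
  | eraseL (p r : List (Option Γ)) (x : Option Γ) : RStep (x :: p, none, r) (p, none, r)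

variable {M S P}

theorem RStep.context {c c' : RCfg Γ Λ S} (h : RStep M S P c c') (u v : List (Option Γ)) :
    RStep M S P (c.1 ++ u, c.2.1, c.2.2 ++ v) (c'.1 ++ u, c'.2.1, c'.2.2 ++ v) := by
  cases h <;> simp only [List.cons_append] <;> constructor <;> assumption

theorem RStep.small {c c' : RCfg Γ Λ S} (h : RStep M S P c c') :
    ∃ d d' : RCfg Γ Λ S, ∃ u v, RStep M S P d d' ∧ c = (d.1 ++ u, d.2.1, d.2.2 ++ v) ∧
      c' = (d'.1 ++ u, d'.2.1, d'.2.2 ++ v) ∧ d.1.length ≤ 2 ∧ d.2.2.length ≤ 2 ∧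
      d'.1.length ≤ 2 ∧ d'.2.2.length ≤ 2 := by
  cases h with
  | write p r q q' a b h => exact ⟨_, _, p, r, .write [] [] q q' a b h, by simp⟩
  | right p r q q' a h => exact ⟨_, _, p, r, .right [] [] q q' a h, by simp⟩
  | left p r q q' a c h => exact ⟨_, _, p, r, .left [] [] q q' a c h, by simp⟩
  | left0 p r q q' a h => exact ⟨_, _, p, r, .left0 [] [] q q' a h, by simp⟩
  | ext p r q => exact ⟨_, _, p, r, .ext [] [] q, by simp⟩
  | halt p r q a h h' => exact ⟨_, _, p, r, .halt [] [] q a h h', by simp⟩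
  | eraseR p r x => exact ⟨_, _, p, r, .eraseR [] [] x, by simp⟩
  | eraseL p r x => exact ⟨_, _, p, r, .eraseL [] [] x, by simp⟩

theorem RStep.det {c c₁ c₂ : RCfg Γ Λ S} (h₁ : RStep M S P c c₁) (h₂ : RStep M S P c c₂)
    (hc : c.2.1 ≠ none) : c₁ = c₂ := by
  cases h₁ <;> cases h₂ <;> simp_all [Subtype.ext_iff]

theorem RStep.of_none {c c' : RCfg Γ Λ S} (h : RStep M S P c c') (hc : c'.2.1 ≠ none) :
    c.2.1 ≠ none ∧ c.1.length + c.2.2.length ≤ c'.1.length + c'.2.2.length := by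
  cases h <;> simp_all <;> omega

/-- The word of a configuration. -/
def rword (c : RCfg Γ Λ S) : List (Option Γ ⊕ Option S) :=
  c.1.reverse.map Sum.inl ++ Sum.inr c.2.1 :: c.2.2.map Sum.inl

theorem rword_context (d : RCfg Γ Λ S) (u v : List (Option Γ)) :
    rword (d.1 ++ u, d.2.1, d.2.2 ++ v) =
      u.reverse.map Sum.inl ++ rword d ++ v.map Sum.inl := by
  simp [rword]

variable (M S P) in
/-- The finite set of rewriting rules. -/
def rrules : Set (List (Option Γ ⊕ Option S) × List (Option Γ ⊕ Option S)) :=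
  {lr | ∃ d d' : RCfg Γ Λ S, RStep M S P d d' ∧ lr = (rword d, rword d') ∧
    d.1.length ≤ 2 ∧ d.2.2.length ≤ 2 ∧ d'.1.length ≤ 2 ∧ d'.2.2.length ≤ 2}

theorem rrules_finite [Finite Γ] (hS : S.Finite) : (rrules M S P).Finite := by
  have := hS.to_subtype
  refine ((List.finite_length_le _ 5).prod (List.finite_length_le _ 5)).subset ?_
  rintro _ ⟨d, d', -, rfl, h1, h2, h3, h4⟩
  simp [rword]
  omega

/-- One step of string rewriting. -/
def RW {A : Type} (R : Set (List A × List A)) (u w : List A) : Prop :=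
  ∃ lr ∈ R, ∃ p s, u = p ++ lr.1 ++ s ∧ w = p ++ lr.2 ++ s

theorem RStep.rw {c c' : RCfg Γ Λ S} (h : RStep M S P c c') :
    RW (rrules M S P) (rword c) (rword c') := by
  obtain ⟨d, d', u, v, h1, rfl, rfl, h2⟩ := h.small
  exact ⟨_, ⟨d, d', h1, rfl, h2⟩, _, _, rword_context d u v, rword_context d' u v⟩

theorem split_unique {α β : Type} {x y : List (α ⊕ β)} {p r : List α} {q q' : β}
    (h : x ++ Sum.inr q :: y = p.map Sum.inl ++ Sum.inr q' :: r.map Sum.inl) :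
    x = p.map Sum.inl ∧ q = q' ∧ y = r.map Sum.inl := by
  induction p generalizing x with
  | nil =>
    cases x with
    | nil => simpa using h
    | cons a x =>
      simp at h
      have : (Sum.inr q : α ⊕ β) ∈ r.map Sum.inl := by rw [← h.2]; simp
      simp at this
  | cons b p ih =>
    cases x with
    | nil => simp at h
    | cons a x =>
      simp at h
      obtain ⟨rfl, h⟩ := h
      obtain ⟨h1, h2, h3⟩ := ih h
      exact ⟨by simp [h1], h2, h3⟩

theorem rword_inv {c d : RCfg Γ Λ S} {p s : List (Option Γ ⊕ Option S)}
    (h : p ++ rword d ++ s = rword c) :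
    ∃ u v, c = (d.1 ++ u, d.2.1, d.2.2 ++ v) ∧ p = u.reverse.map Sum.inl ∧ s = v.map Sum.inl := by
  obtain ⟨c1, c2, c3⟩ := c
  obtain ⟨d1, d2, d3⟩ := d
  simp only [rword] at h
  have h' : (p ++ d1.reverse.map Sum.inl) ++ Sum.inr d2 :: (d3.map Sum.inl ++ s) =
    c1.reverse.map Sum.inl ++ Sum.inr c2 :: c3.map Sum.inl := by rw [← h]; simp
  obtain ⟨h1, rfl, h3⟩ := split_unique h'
  obtain ⟨a, b, h4, h5, h6⟩ := List.append_eq_map_iff.1 h1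
  obtain ⟨a', b', h7, h8, h9⟩ := List.append_eq_map_iff.1 h3
  have e1 := List.map_injective_iff.2 Sum.inl_injective h6
  have e2 := List.map_injective_iff.2 Sum.inl_injective h8
  subst e1 e2 h7
  refine ⟨a.reverse, b', ?_, by simp [h5], h9.symm⟩
  have : c1 = d1 ++ a.reverse := by
    have := congrArg List.reverse h4
    simpa using this
  rw [this]

theorem closed_words {D : Set (RCfg Γ Λ S)} (hD : ∀ c c', RStep M S P c c' → (c ∈ D ↔ c' ∈ D)) :
    ∀ lr ∈ rrules M S P, ∀ p s, p ++ lr.1 ++ s ∈ rword '' D ↔ p ++ lr.2 ++ s ∈ rword '' D := by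
  rintro _ ⟨d, d', h, rfl, -⟩ p s
  constructor
  · rintro ⟨c, hc, e⟩
    obtain ⟨u, v, rfl, rfl, rfl⟩ := rword_inv e.symm
    exact ⟨_, (hD _ _ (h.context u v)).1 hc, rword_context _ _ _⟩
  · rintro ⟨c, hc, e⟩
    obtain ⟨u, v, rfl, rfl, rfl⟩ := rword_inv e.symm
    exact ⟨_, (hD _ _ (h.context u v)).2 hc, rword_context _ _ _⟩

open Relation in
theorem finite_closed [Finite Γ] (hS : S.Finite) (F : RCfg Γ Λ S) (hF : F.2.1 ≠ none)
    (hirr : ∀ c, ¬ RStep M S P F c) :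
    ∃ D : Set (RCfg Γ Λ S), D.Finite ∧ (∀ c c', RStep M S P c c' → (c ∈ D ↔ c' ∈ D)) ∧
      (∀ c, ReflTransGen (RStep M S P) c F → c ∈ D) ∧ ∀ c ∈ D, c.2.1 ≠ none := by
  have := hS.to_subtype
  have key : ∀ c, ReflTransGen (RStep M S P) c F →
      c.2.1 ≠ none ∧ c.1.length + c.2.2.length ≤ F.1.length + F.2.2.length := by
    intro c hc
    induction hc using ReflTransGen.head_induction_on with
    | refl => exact ⟨hF, le_rfl⟩
    | head h _ ih => exact ⟨(h.of_none ih.1).1, (h.of_none ih.1).2.trans ih.2⟩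
  refine ⟨{c | ReflTransGen (RStep M S P) c F}, ?_, ?_, fun _ h => h, fun c hc => (key c hc).1⟩
  · refine ((List.finite_length_le _ (F.1.length + F.2.2.length)).prod
      ((Set.finite_univ (α := Option S)).prod
        (List.finite_length_le _ (F.1.length + F.2.2.length)))).subset ?_
    intro c hc
    have := (key c hc).2
    simp
    omega
  · intro c c' h
    refine ⟨fun hc => ?_, fun hc => ReflTransGen.head h hc⟩
    rcases ReflTransGen.cases_head hc with rfl | ⟨d, h1, h2⟩
    · exact (hirr _ h).elim
    · rw [h.det h1 (key c hc).1]; exact h2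

/-- Representation of a machine configuration. -/
def Rep (c : TM0.Cfg Γ Λ) (d : RCfg Γ Λ S) : Prop :=
  ∃ (h : c.q ∈ S) (p r : List Γ), d = (p.map some ++ [none], some ⟨c.q, h⟩, r.map some ++ [none]) ∧
    c.Tape = Tape.mk' (ListBlank.mk p) (ListBlank.mk r)

open Relation

theorem Rep.norm {c : TM0.Cfg Γ Λ} {d : RCfg Γ Λ S} (h : Rep c d) :
    ∃ (h : c.q ∈ S) (p r : List Γ) (a : Γ), ReflTransGen (RStep M S P) d
      (p.map some ++ [none], some ⟨c.q, h⟩, some a :: (r.map some ++ [none])) ∧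
    c.Tape = Tape.mk' (ListBlank.mk p) (ListBlank.mk (a :: r)) ∧ c.Tape.head = a := by
  obtain ⟨hq, p, r, rfl, hT⟩ := h
  cases r with
  | nil =>
    refine ⟨hq, p, [], default, ReflTransGen.single ?_, ?_, ?_⟩
    · simpa using RStep.ext _ _ _
    · rw [hT]; congr 1
      rw [← ListBlank.cons_mk]
      exact Quotient.sound' (Or.inl ⟨1, rfl⟩)
    · rw [hT]; rfl
  | cons a r =>
    refine ⟨hq, p, r, a, .refl, hT, ?_⟩
    rw [hT]; rfl

theorem Rep.step (hM : TM0.Supports M S) {c c' : TM0.Cfg Γ Λ} {d : RCfg Γ Λ S} (h : Rep c d)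
    (hc : c' ∈ TM0.step M c) :
    ∃ d', ReflTransGen (RStep M S P) d d' ∧ Rep c' d' := by
  obtain ⟨hq, p, r, a, h1, h2, h3⟩ := h.norm (M := M) (P := P)
  obtain ⟨q, T⟩ := c
  simp only at h1 h2 h3 hq
  simp only [TM0.step, Option.mem_def, Option.map_eq_some_iff, h3] at hc
  obtain ⟨⟨q', s⟩, hs, rfl⟩ := hc
  have hq' : q' ∈ S := hM.2 hs hq
  cases s with
  | move dir =>
    cases dir with
    | left =>
      cases p with
      | nil =>
        refine ⟨_, h1.tail (RStep.left0 _ _ ⟨q, hq⟩ ⟨q', hq'⟩ a hs), hq', [], default :: a :: r, by simp, ?_⟩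
        simp [h2, Tape.move_left_mk']
      | cons b p =>
        refine ⟨_, h1.tail (RStep.left _ _ ⟨q, hq⟩ ⟨q', hq'⟩ a b hs), hq', p, b :: a :: r, by simp, ?_⟩
        simp [h2, Tape.move_left_mk']
    | right =>
      refine ⟨_, h1.tail (RStep.right _ _ ⟨q, hq⟩ ⟨q', hq'⟩ a hs), hq', a :: p, r, by simp, ?_⟩
      simp [h2, Tape.move_right_mk']
  | write b =>
    refine ⟨_, h1.tail (RStep.write _ _ ⟨q, hq⟩ ⟨q', hq'⟩ a b hs), hq', p, b :: r, by simp, ?_⟩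
    simp [h2, Tape.write_mk']

theorem Rep.steps (hM : TM0.Supports M S) {c c' : TM0.Cfg Γ Λ} {d : RCfg Γ Λ S} (h : Rep c d)
    (hc : StateTransition.Reaches (TM0.step M) c c') :
    ∃ d', ReflTransGen (RStep M S P) d d' ∧ Rep c' d' := by
  induction hc with
  | refl => exact ⟨d, .refl, h⟩
  | tail _ h2 ih =>
    obtain ⟨d', h3, h4⟩ := ih
    obtain ⟨d'', h5, h6⟩ := h4.step (P := P) hM h2
    exact ⟨d'', h3.trans h5, h6⟩

theorem erase_all (p r : List (Option Γ)) :
    ReflTransGen (RStep M S P) (p, none, r) ([], none, []) := by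
  have h1 : ReflTransGen (RStep M S P) (p, none, r) (p, none, []) := by
    induction r with
    | nil => exact .refl
    | cons x r ih => exact ih.head (RStep.eraseR _ _ _)
  refine h1.trans ?_
  clear h1
  induction p with
  | nil => exact .refl
  | cons x r ih => exact ih.head (RStep.eraseL _ _ _)

end Rewriting
open Relation in
theorem exists_rewriting (f : ℕ →. ℕ) (hf : Partrec f) :
    ∃ (A : Type) (_ : Finite A) (R : Set (List A × List A)) (x y v : List A) (a : A),
      R.Finite ∧ ∀ m : ℕ,
        (0 ∈ f (2 ^ m) → ∃ C : Set (List A), C.Finite ∧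
          (∀ lr ∈ R, ∀ p s, p ++ lr.1 ++ s ∈ C ↔ p ++ lr.2 ++ s ∈ C) ∧
          x ++ (List.replicate m a ++ y) ∈ C ∧ v ∉ C) ∧
        (1 ∈ f (2 ^ m) → ReflTransGen (RW R) (x ++ (List.replicate m a ++ y)) v) := by
  obtain ⟨Γ, Λ, _, _, _, M, S, P, x, a, hS, hM, H⟩ := exists_tm0 f hf
  have := hS.to_subtype
  let q₀ : S := ⟨default, hM.1⟩
  let d₀ : ℕ → RCfg Γ Λ S := fun m =>
    ([none], some q₀, (x ++ List.replicate m a).map some ++ [none])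
  have hrep : ∀ m, Rep (TM0.init (x ++ List.replicate m a)) (d₀ m) := fun m =>
    ⟨hM.1, [], x ++ List.replicate m a, rfl, rfl⟩
  have hw : ∀ m, Sum.inl none :: Sum.inr (some q₀) :: x.map (fun b => Sum.inl (some b)) ++
      (List.replicate m (Sum.inl (some a)) ++ [Sum.inl none]) = rword (d₀ m) := by
    intro m
    simp [d₀, rword, Function.comp_def]
  refine ⟨Option Γ ⊕ Option S, inferInstance, rrules M S P,
    Sum.inl none :: Sum.inr (some q₀) :: x.map (fun b => Sum.inl (some b)), [Sum.inl none],
    [Sum.inr none], Sum.inl (some a), rrules_finite hS, fun m => ⟨fun h => ?_, fun h => ?_⟩⟩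
  · obtain ⟨c, hc, hP⟩ := (H m).1 h
    rw [StateTransition.mem_eval] at hc
    obtain ⟨d, h1, h2⟩ := (hrep m).steps (P := P) hM hc.1
    obtain ⟨hq, p, r, b, h3, h4, h5⟩ := h2.norm (M := M) (P := P)
    have hb : M c.q b = none := by
      have := hc.2
      simpa [TM0.step, h5] using this
    obtain ⟨D, hD1, hD2, hD3, hD4⟩ := finite_closed (M := M) (P := P) hS
      (p.map some ++ [none], some ⟨c.q, hq⟩, some b :: (r.map some ++ [none])) (by simp) (by
        intro c' hc'
        rw [h5] at hP
        generalize p.map some ++ [none] = p' at hc'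
        cases hc' <;> simp_all)
    refine ⟨rword '' D, hD1.image _, closed_words hD2, ⟨d₀ m, hD3 _ (h1.trans h3), (hw m).symm⟩, ?_⟩
    rintro ⟨c', hc', e⟩
    obtain ⟨u, v, rfl, -⟩ := rword_inv (d := (([], none, []) : RCfg Γ Λ S)) (p := []) (s := [])
      (c := c') (by rw [e]; rfl)
    exact hD4 _ hc' rfl
  · obtain ⟨c, hc, hP⟩ := (H m).2 h
    rw [StateTransition.mem_eval] at hc
    obtain ⟨d, h1, h2⟩ := (hrep m).steps (P := P) hM hc.1
    obtain ⟨hq, p, r, b, h3, h4, h5⟩ := h2.norm (M := M) (P := P)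
    have hb : M c.q b = none := by
      have := hc.2
      simpa [TM0.step, h5] using this
    have h6 := ((h1.trans h3).tail (RStep.halt _ _ ⟨c.q, hq⟩ b hb (h5 ▸ hP))).trans
      (erase_all _ _)
    rw [hw m]
    exact h6.lift rword (fun _ _ h => h.rw)


open scoped commutatorElement

section GroupPart

theorem comm_assoc {G : Type} [Group G] {a b c : G} (h1 : Commute a c)
    (h2 : Commute ⁅b, c⁆ ⁅a, b⁆) (h3 : Commute ⁅b, c⁆ c) : ⁅a, ⁅b, c⁆⁆ = ⁅⁅a, b⁆, c⁆ := by
  have key : a * ⁅b, c⁆ * a⁻¹ = ⁅b, c⁆ * ⁅⁅a, b⁆, c⁆ := by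
    have e1 : a * ⁅b, c⁆ * a⁻¹ = ⁅a, b⁆ * (⁅b, c⁆ * c) * ⁅a, b⁆⁻¹ * c⁻¹ := by
      have h1' : a * c⁻¹ = c⁻¹ * a := h1.inv_right.eq
      have : a * ⁅b, c⁆ * a⁻¹ = a * b * c * b⁻¹ * (c⁻¹ * a⁻¹) := by
        simp only [commutatorElement_def]; group
      rw [this, (h1.inv_inv.eq).symm]
      have h1'' : c = a⁻¹ * c * a := by rw [mul_assoc, ← h1.eq]; group
      nth_rewrite 1 [h1'']
      simp only [commutatorElement_def]; group
    rw [e1, ← mul_assoc, ← h2.eq]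
    simp only [commutatorElement_def ⁅a, b⁆ c]; group
  have h4 : Commute ⁅b, c⁆ ⁅⁅a, b⁆, c⁆ := by
    rw [commutatorElement_def ⁅a, b⁆ c]
    exact ((h2.mul_right h3).mul_right h2.inv_right).mul_right h3.inv_right
  rw [commutatorElement_def a ⁅b, c⁆, key, h4.eq, mul_inv_cancel_right]

theorem commute_comm {G : Type} [Group G] {a b c : G} (h1 : Commute c a) (h2 : Commute c b) :
    Commute c ⁅a, b⁆ := by
  rw [commutatorElement_def]
  exact ((h1.mul_right h2).mul_right h1.inv_right).mul_right h2.inv_right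

variable {A G : Type} [Group G]

/-- The (fixed) value of a word. -/
def tw (e : Fin 5 → Fin 5 → Option A → G) : List A → G
  | [] => e 1 0 none
  | s :: w => ⁅e 1 2 (some s), ⁅e 2 1 none, tw e w⁆⁆

/-- The relations. -/
structure Good (R : Set (List A × List A)) (e : Fin 5 → Fin 5 → Option A → G) : Prop where
  comm : ∀ i j k l s t, i ≠ j → k ≠ l → j ≠ k → i ≠ l → e i j s * e k l t = e k l t * e i j s
  unl : ∀ i j k s, i ≠ j → j ≠ k → i ≠ k → ⁅e i j none, e j k s⁆ = e i k s
  unr : ∀ i j k s, i ≠ j → j ≠ k → i ≠ k → ⁅e i j s, e j k none⁆ = e i k s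
  rule : ∀ lr ∈ R, tw e lr.1 = tw e lr.2

theorem exists_avoid (i j k l : Fin 5) : ∃ m : Fin 5, m ≠ i ∧ m ≠ j ∧ m ≠ k ∧ m ≠ l := by
  have h : ({i, j, k, l} : Finset (Fin 5)).card < (Finset.univ : Finset (Fin 5)).card :=
    Finset.card_le_four.trans_lt (by simp)
  obtain ⟨m, -, hm⟩ := Finset.exists_mem_notMem_of_card_lt_card h
  exact ⟨m, by simpa using hm⟩

/-- An index avoiding two given ones. -/
noncomputable def pick (i j : Fin 5) : Fin 5 := (exists_avoid i j i j).choose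

theorem pick_ne_left (i j : Fin 5) : pick i j ≠ i := (exists_avoid i j i j).choose_spec.1
theorem pick_ne_right (i j : Fin 5) : pick i j ≠ j := (exists_avoid i j i j).choose_spec.2.1

/-- The values of words at all indices. -/
noncomputable def tv (e : Fin 5 → Fin 5 → Option A → G) : List A → Fin 5 → Fin 5 → G
  | [], i, j => e i j none
  | s :: w, i, j => ⁅e i (pick i j) (some s), tv e w (pick i j) j⁆

variable {R : Set (List A × List A)} {e : Fin 5 → Fin 5 → Option A → G}

/-- Commutation of the value of a word with generators. -/
def CommB (e : Fin 5 → Fin 5 → Option A → G) (v : List A) : Prop :=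
  ∀ i j k l t, i ≠ j → k ≠ l → j ≠ k → i ≠ l → Commute (tv e v i j) (e k l t)

theorem tv_main (h : Good R e) (w : List A) :
    (∀ i k j, i ≠ k → k ≠ j → i ≠ j → ⁅e i k none, tv e w k j⁆ = tv e w i j) ∧
    (∀ i k j s, i ≠ k → k ≠ j → i ≠ j → ⁅e i k (some s), tv e w k j⁆ = tv e (s :: w) i j) ∧
    CommB e w ∧
    (∀ v, CommB e v → ∀ i j k l, i ≠ j → k ≠ l → j ≠ k → i ≠ l →
      Commute (tv e v i j) (tv e w k l)) := by
  induction w with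
  | nil =>
    refine ⟨fun i k j h1 h2 h3 => h.unl _ _ _ _ h1 h2 h3, fun i k j s h1 h2 h3 => ?_,
      fun i j k l t h1 h2 h3 h4 => h.comm _ _ _ _ _ _ h1 h2 h3 h4,
      fun v hv i j k l h1 h2 h3 h4 => hv _ _ _ _ _ h1 h2 h3 h4⟩
    simp only [tv]
    rw [h.unr _ _ _ _ h1 h2 h3,
      h.unr _ _ _ _ (pick_ne_left i j).symm (pick_ne_right i j) h3]
  | cons t w ih =>
    obtain ⟨hU, hI, hB, hB'⟩ := ih
    have B : CommB e (t :: w) := by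
      intro i j k l u h1 h2 h3 h4
      obtain ⟨m, hi, hj, hk, hl⟩ := exists_avoid i j k l
      rw [← hI i m j t hi.symm hj h1]
      exact (commute_comm (h.comm _ _ _ _ _ _ hi.symm h2 hk h4).symm
        (hB _ _ _ _ _ hj h2 h3 hl).symm).symm
    have B' : ∀ v, CommB e v → ∀ i j k l, i ≠ j → k ≠ l → j ≠ k → i ≠ l →
        Commute (tv e v i j) (tv e (t :: w) k l) := by
      intro v hv i j k l h1 h2 h3 h4
      obtain ⟨m, hi, hj, hk, hl⟩ := exists_avoid i j k l
      rw [← hI k m l t hk.symm hl h2]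
      exact commute_comm (hv _ _ _ _ _ h1 hk.symm h3 hi.symm)
        (hB' v hv _ _ _ _ h1 hl hj.symm h4)
    have U : ∀ i k j, i ≠ k → k ≠ j → i ≠ j →
        ⁅e i k none, tv e (t :: w) k j⁆ = tv e (t :: w) i j := by
      intro i k j h1 h2 h3
      obtain ⟨m, hi, hj, hk, -⟩ := exists_avoid i j k k
      have e1 := hI k m j t hk.symm hj h2
      have e2 := h.unl i k m (some t) h1 hk.symm hi.symm
      rw [← e1, comm_assoc, e2, hI i m j t hi.symm hj h3]
      · exact (hB _ _ _ _ _ hj h1 h3.symm hk).symm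
      · rw [e1, e2]
        exact B _ _ _ _ _ h2 hi.symm h3.symm hk.symm
      · rw [e1]
        exact hB' _ B _ _ _ _ h2 hj hj.symm h2
    refine ⟨U, ?_, B, B'⟩
    have indep : ∀ i j k k' s, i ≠ j → k ≠ i → k ≠ j → k' ≠ i → k' ≠ j → k ≠ k' →
        ⁅e i k (some s), tv e (t :: w) k j⁆ = ⁅e i k' (some s), tv e (t :: w) k' j⁆ := by
      intro i j k k' s h1 h2 h3 h4 h5 h6
      have e1 := U k k' j h6 h5 h3
      have e2 := h.unr i k k' (some s) h2.symm h6 h4.symm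
      rw [← e1, comm_assoc, e2]
      · exact (B _ _ _ _ _ h5 h2.symm h1.symm h6.symm).symm
      · rw [e1, e2]
        exact B _ _ _ _ _ h3 h4.symm h1.symm h6
      · rw [e1]
        exact B' _ B _ _ _ _ h3 h5 h5.symm h3
    intro i k j s h1 h2 h3
    by_cases hk : k = pick i j
    · subst hk; rfl
    · exact indep i j k (pick i j) s h3 h1.symm h2 (pick_ne_left i j) (pick_ne_right i j) hk

theorem tv_U (h : Good R e) (w : List A) {i k j : Fin 5} (h1 : i ≠ k) (h2 : k ≠ j) (h3 : i ≠ j) :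
    ⁅e i k none, tv e w k j⁆ = tv e w i j := (tv_main h w).1 _ _ _ h1 h2 h3

theorem tv_I (h : Good R e) (w : List A) {i k j : Fin 5} (s : A)
    (h1 : i ≠ k) (h2 : k ≠ j) (h3 : i ≠ j) :
    ⁅e i k (some s), tv e w k j⁆ = tv e (s :: w) i j := (tv_main h w).2.1 _ _ _ _ h1 h2 h3

theorem tv_B (h : Good R e) (w : List A) : CommB e w := (tv_main h w).2.2.1

theorem tv_B' (h : Good R e) (v w : List A) {i j k l : Fin 5}
    (h1 : i ≠ j) (h2 : k ≠ l) (h3 : j ≠ k) (h4 : i ≠ l) :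
    Commute (tv e v i j) (tv e w k l) := (tv_main h w).2.2.2 v (tv_B h v) _ _ _ _ h1 h2 h3 h4

theorem tv_E (h : Good R e) (w : List A) (s : Option A) {i k j : Fin 5}
    (h1 : i ≠ k) (h2 : k ≠ j) (h3 : i ≠ j) :
    ⁅tv e w i k, e k j s⁆ = tv e (w ++ s.toList) i j := by
  induction w generalizing i k with
  | nil =>
    simp only [tv]
    rw [h.unl _ _ _ _ h1 h2 h3]
    cases s with
    | none => rfl
    | some s =>
      rw [List.nil_append, Option.toList_some, ← tv_I h [] s h1 h2 h3]
      exact (h.unr _ _ _ _ h1 h2 h3).symm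
  | cons t w ih =>
    obtain ⟨m, hi, hj, hk, -⟩ := exists_avoid i j k k
    have e1 := tv_I h w t hi.symm hk h1
    have e2 := ih (i := m) (k := k) hk h2 hj
    rw [← e1, ← comm_assoc, e2, tv_I h _ t hi.symm hj h3, List.cons_append]
    · exact h.comm _ _ _ _ _ _ hi.symm h2 hk h3
    · rw [e2, e1]
      exact tv_B' h _ _ hj h1 h3.symm hk
    · rw [e2]
      exact tv_B h _ _ _ _ _ _ hj h2 h2.symm hj

theorem tw_eq (h : Good R e) (w : List A) : tw e w = tv e w 1 0 := by
  induction w with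
  | nil => rfl
  | cons s w ih =>
    rw [tw, ih, tv_U h w (by decide) (by decide) (by decide),
      tv_I h w s (by decide) (by decide) (by decide)]

theorem rule_all (h : Good R e) {lr : List A × List A} (hlr : lr ∈ R) {i j : Fin 5} (hij : i ≠ j) :
    tv e lr.1 i j = tv e lr.2 i j := by
  have h0 := h.rule lr hlr
  rw [tw_eq h, tw_eq h] at h0
  have hl : ∀ i k j, i ≠ k → k ≠ j → i ≠ j → tv e lr.1 k j = tv e lr.2 k j →
      tv e lr.1 i j = tv e lr.2 i j := by
    intro i k j h1 h2 h3 h4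
    rw [← tv_U h lr.1 h1 h2 h3, h4, tv_U h lr.2 h1 h2 h3]
  have hr : ∀ i k j, i ≠ k → k ≠ j → i ≠ j → tv e lr.1 i k = tv e lr.2 i k →
      tv e lr.1 i j = tv e lr.2 i j := by
    intro i k j h1 h2 h3 h4
    have e1 := tv_E h lr.1 none h1 h2 h3
    have e2 := tv_E h lr.2 none h1 h2 h3
    simp only [Option.toList_none, List.append_nil] at e1 e2
    rw [← e1, h4, e2]
  obtain ⟨c, c0, c1, ci, cj⟩ := exists_avoid 0 1 i j
  have h1 := hl c 1 0 c1 (by decide) c0 h0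
  have h2 : tv e lr.1 c j = tv e lr.2 c j := by
    by_cases hj : j = 0
    · subst hj; exact h1
    · exact hr c 0 j c0 (Ne.symm hj) cj h1
  exact hl i c j ci.symm cj hij h2

theorem tv_rw (h : Good R e) {u w : List A} (huw : RW R u w) : tw e u = tw e w := by
  obtain ⟨lr, hlr, p, s, rfl, rfl⟩ := huw
  rw [tw_eq h, tw_eq h]
  suffices H : ∀ i j : Fin 5, i ≠ j → tv e (p ++ lr.1 ++ s) i j = tv e (p ++ lr.2 ++ s) i j from
    H 1 0 (by decide)
  have H1 : ∀ i j : Fin 5, i ≠ j → tv e (lr.1 ++ s) i j = tv e (lr.2 ++ s) i j := by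
    induction s using List.reverseRecOn with
    | nil => intro i j hij; simpa using rule_all h hlr hij
    | append_singleton s a ih =>
      intro i j hij
      obtain ⟨m, hi, hj, -, -⟩ := exists_avoid i j i j
      have e1 := tv_E h (lr.1 ++ s) (some a) hi.symm hj hij
      have e2 := tv_E h (lr.2 ++ s) (some a) hi.symm hj hij
      simp only [Option.toList_some, List.append_assoc] at e1 e2
      rw [← e1, ih i m hi.symm, e2]
  induction p with
  | nil => simpa using H1
  | cons a p ih =>
    intro i j hij
    obtain ⟨m, hi, hj, -, -⟩ := exists_avoid i j i j
    simp only [List.cons_append]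
    rw [← tv_I h _ a hi.symm hj hij, ih m j hj, tv_I h _ a hi.symm hj hij]

theorem tw_rws (h : Good R e) {u w : List A} (huw : Relation.ReflTransGen (RW R) u w) :
    tw e u = tw e w := by
  induction huw with
  | refl => rfl
  | tail _ h2 ih => exact ih.trans (tv_rw h h2)

end GroupPart

section Model

variable {K : Type} [Ring K]

theorem sms_ne {i j k l : Fin 5} (h : j ≠ k) (a b : K) :
    Matrix.single i j a * Matrix.single k l b = 0 :=
  Matrix.single_mul_single_of_ne _ _ _ _ h _

/-- Elementary matrices as units. -/
def elUnit (i j : Fin 5) (a : K) : (Matrix (Fin 5) (Fin 5) K)ˣ :=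
  if h : i = j then 1 else
  { val := 1 + Matrix.single i j a
    inv := 1 - Matrix.single i j a
    val_inv := by
      simp [mul_sub, add_mul, sms_ne (h := Ne.symm h)]
    inv_val := by
      simp [mul_add, sub_mul, sms_ne (h := Ne.symm h)] }

theorem elUnit_val {i j : Fin 5} (h : i ≠ j) (a : K) :
    (elUnit i j a : Matrix (Fin 5) (Fin 5) K) = 1 + Matrix.single i j a := by
  simp [elUnit, h]

theorem elUnit_comm {i j k l : Fin 5} (a b : K) (h1 : i ≠ j) (h2 : k ≠ l) (h3 : j ≠ k)
    (h4 : i ≠ l) : elUnit i j a * elUnit k l b = elUnit k l b * elUnit i j a := by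
  ext1
  simp only [Units.val_mul, elUnit_val h1, elUnit_val h2, mul_add, add_mul, mul_one, one_mul,
    sms_ne (h := h3), sms_ne (h := h4.symm)]
  abel

theorem elUnit_commutator {i j k : Fin 5} (a b : K) (h1 : i ≠ j) (h2 : j ≠ k) (h3 : i ≠ k) :
    ⁅elUnit i j a, elUnit j k b⁆ = elUnit i k (a * b) := by
  rw [commutatorElement_def, mul_inv_eq_iff_eq_mul, mul_inv_eq_iff_eq_mul]
  ext1
  simp only [Units.val_mul, elUnit_val h1, elUnit_val h2, elUnit_val h3, mul_add, add_mul, mul_one,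
    one_mul, Matrix.single_mul_single_same, sms_ne (h := h3.symm),
    sms_ne (h := h2.symm), add_zero]
  abel

theorem elUnit_injective {i j : Fin 5} (h : i ≠ j) {a b : K} (hab : elUnit i j a = elUnit i j b) :
    a = b := by
  have := congrArg (fun u : (Matrix (Fin 5) (Fin 5) K)ˣ => (u : Matrix (Fin 5) (Fin 5) K) i j) hab
  simpa [elUnit_val h] using this

theorem exists_model {A : Type} [Finite A] {R : Set (List A × List A)} {C : Set (List A)}
    (hC : C.Finite)
    (hR : ∀ lr ∈ R, ∀ p s, p ++ lr.1 ++ s ∈ C ↔ p ++ lr.2 ++ s ∈ C) {u v : List A}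
    (hu : u ∈ C) (hv : v ∉ C) :
    ∃ (G : Type) (_ : Group G) (_ : Finite G) (e : Fin 5 → Fin 5 → Option A → G),
      Good R e ∧ tw e u ≠ tw e v := by
  classical
  let c : Con (FreeMonoid A) :=
    { r := fun x y => ∀ p s : List A, p ++ x.toList ++ s ∈ C ↔ p ++ y.toList ++ s ∈ C
      iseqv := ⟨fun _ _ _ => Iff.rfl, fun h p s => (h p s).symm,
        fun h1 h2 p s => (h1 p s).trans (h2 p s)⟩
      mul' := by
        intro w x y z h1 h2 p s
        have e1 := h1 p (y.toList ++ s)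
        have e2 := h2 (p ++ x.toList) s
        simp only [FreeMonoid.toList_mul, List.append_assoc] at e1 e2 ⊢
        exact e1.trans e2 }
  have hc : ∀ x y : FreeMonoid A, c x y ↔
    ∀ p s : List A, p ++ x.toList ++ s ∈ C ↔ p ++ y.toList ++ s ∈ C := fun x y => Iff.rfl
  obtain ⟨N, hN⟩ : ∃ N, ∀ w ∈ C, w.length ≤ N := by
    obtain ⟨N, hN⟩ := (hC.image List.length).bddAbove
    exact ⟨N, fun w hw => hN ⟨w, hw, rfl⟩⟩
  let F : Set (List A × List A) := {w | w.length ≤ N} ×ˢ {w | w.length ≤ N}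
  have hF : Finite F := ((List.finite_length_le A N).prod (List.finite_length_le A N)).to_subtype
  have hfin : Finite c.Quotient := by
    let g : c.Quotient → Set F := fun q => Con.liftOn q
      (fun x => {ps : F | ps.1.1 ++ x.toList ++ ps.1.2 ∈ C}) (by
        intro x y hxy
        ext ps
        exact hxy _ _)
    refine Finite.of_injective g ?_
    intro x y
    refine Con.induction_on₂ x y ?_
    intro x y hxy
    refine (Con.eq c).2 ((hc _ _).2 fun p s => ?_)
    by_cases hps : p.length ≤ N ∧ s.length ≤ N
    · exact Set.ext_iff.1 hxy ⟨(p, s), hps⟩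
    · constructor <;> intro h <;> exfalso <;> apply hps <;> have := hN _ h <;>
        simp at this <;> omega
  let K := MonoidAlgebra (ZMod 2) c.Quotient
  have hK : Finite K := Finite.of_injective
    (fun (x : K) => (x.coeff : c.Quotient → ZMod 2))
    (fun x y h => MonoidAlgebra.ext (DFunLike.coe_injective h))
  let φ : List A → K := fun w => MonoidAlgebra.of (ZMod 2) c.Quotient ((FreeMonoid.ofList w : FreeMonoid A) : c.Quotient)
  have φ1 : φ [] = 1 := by
    simp [φ]
    rfl
  have φm : ∀ w w', φ (w ++ w') = φ w * φ w' := by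
    intro w w'
    simp only [φ, FreeMonoid.ofList_append, Con.coe_mul, map_mul]
  have φr : ∀ w w', φ w = φ w' ↔ ∀ p s : List A, p ++ w ++ s ∈ C ↔ p ++ w' ++ s ∈ C := by
    intro w w'
    simp only [φ]
    rw [MonoidAlgebra.of_injective.eq_iff, Con.eq]
    exact Iff.rfl
  let e : Fin 5 → Fin 5 → Option A → (Matrix (Fin 5) (Fin 5) K)ˣ :=
    fun i j s => elUnit i j (φ s.toList)
  have tw_e : ∀ w, tw e w = elUnit 1 0 (φ w) := by
    intro w
    induction w with
    | nil => rfl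
    | cons s w ih =>
      rw [tw, ih]
      simp only [e]
      rw [elUnit_commutator _ _ (by decide) (by decide) (by decide),
        elUnit_commutator _ _ (by decide) (by decide) (by decide), ← φm, ← φm]
      rfl
  refine ⟨(Matrix (Fin 5) (Fin 5) K)ˣ, inferInstance, ?_, e, ⟨?_, ?_, ?_, ?_⟩, ?_⟩
  · have : Finite (Matrix (Fin 5) (Fin 5) K) := inferInstanceAs (Finite (Fin 5 → Fin 5 → K))
    infer_instance
  · intro i j k l s t h1 h2 h3 h4
    exact elUnit_comm _ _ h1 h2 h3 h4
  · intro i j k s h1 h2 h3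
    simp only [e]
    rw [elUnit_commutator _ _ h1 h2 h3, Option.toList_none, φ1, one_mul]
  · intro i j k s h1 h2 h3
    simp only [e]
    rw [elUnit_commutator _ _ h1 h2 h3, Option.toList_none, φ1, mul_one]
  · intro lr hlr
    rw [tw_e, tw_e, (φr _ _).2 (hR lr hlr)]
  · rw [tw_e, tw_e]
    intro h
    have := (φr _ _).1 (elUnit_injective (by decide) h) [] []
    simp at this
    exact hv (this.1 hu)

end Model

section Formulas
open Encodable FirstOrder.Language

variable {V : Type}

/-- Multiplication of terms. -/
def mulT (a b : grpLang.Term V) : grpLang.Term V :=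
  .func (l := 2) (show grpLang.Functions 2 from ()) ![a, b]

/-- Inversion of terms. -/
def invT (a : grpLang.Term V) : grpLang.Term V :=
  .func (l := 1) (show grpLang.Functions 1 from ()) ![a]

/-- Commutator of terms. -/
def commT (a b : grpLang.Term V) : grpLang.Term V :=
  mulT (mulT (mulT a b) (invT a)) (invT b)

theorem realize_mulT {G : Type} [Group G] (x : V → G) (a b : grpLang.Term V) :
    (mulT a b).realize x = a.realize x * b.realize x := rfl

theorem realize_invT {G : Type} [Group G] (x : V → G) (a : grpLang.Term V) :
    (invT a).realize x = (a.realize x)⁻¹ := rfl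

theorem realize_commT {G : Type} [Group G] (x : V → G) (a b : grpLang.Term V) :
    (commT a b).realize x = ⁅a.realize x, b.realize x⁆ := rfl

/-- The implication from a list of equations to an equation. -/
def impl {k : ℕ} (L : List (grpLang.Term (Empty ⊕ Fin k) × grpLang.Term (Empty ⊕ Fin k)))
    (t t' : grpLang.Term (Empty ⊕ Fin k)) : grpLang.BoundedFormula Empty k :=
  match L with
  | [] => .equal t t'
  | p :: L => .imp (.equal p.1 p.2) (impl L t t')

theorem impl_isQF {k : ℕ} (L : List (grpLang.Term (Empty ⊕ Fin k) × grpLang.Term (Empty ⊕ Fin k)))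
    (t t' : grpLang.Term (Empty ⊕ Fin k)) : (impl L t t').IsQF := by
  induction L with
  | nil => exact (BoundedFormula.IsAtomic.equal _ _).isQF
  | cons p L ih => exact (BoundedFormula.IsAtomic.equal _ _).isQF.imp ih

theorem realize_impl {G : Type} [Group G] {k : ℕ}
    (L : List (grpLang.Term (Empty ⊕ Fin k) × grpLang.Term (Empty ⊕ Fin k)))
    (t t' : grpLang.Term (Empty ⊕ Fin k)) (v : Empty → G) (x : Fin k → G) :
    (impl L t t').Realize v x ↔
      ((∀ p ∈ L, p.1.realize (Sum.elim v x) = p.2.realize (Sum.elim v x)) →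
        t.realize (Sum.elim v x) = t'.realize (Sum.elim v x)) := by
  induction L with
  | nil => simp [impl, BoundedFormula.Realize]
  | cons p L ih =>
    simp only [impl, BoundedFormula.realize_imp, ih, List.forall_mem_cons, and_imp]
    rfl

theorem listEncode_impl {k : ℕ}
    (L : List (grpLang.Term (Empty ⊕ Fin k) × grpLang.Term (Empty ⊕ Fin k)))
    (t' : grpLang.Term (Empty ⊕ Fin k)) :
    ∃ pre, ∀ t, (impl L t t').listEncode = pre ++ [Sum.inl ⟨k, t⟩, Sum.inl ⟨k, t'⟩] := by
  induction L with
  | nil => exact ⟨[], fun t => rfl⟩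
  | cons p L ih =>
    obtain ⟨pre, h⟩ := ih
    refine ⟨(Sum.inr (Sum.inr 0) :: (BoundedFormula.equal p.1 p.2).listEncode) ++ pre,
      fun t => ?_⟩
    have h1 : (impl (p :: L) t t').listEncode = (Sum.inr (Sum.inr 0) ::
      (BoundedFormula.equal p.1 p.2).listEncode) ++ (impl L t t').listEncode := by
      rfl
    rw [h1, h, List.append_assoc]

theorem listEncode_alls {k : ℕ} (φ : grpLang.BoundedFormula Empty k) :
    φ.alls.listEncode = List.replicate k (Sum.inr (Sum.inr 1)) ++ φ.listEncode := by
  induction k with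
  | zero => rfl
  | succ k ih =>
    rw [BoundedFormula.alls, ih, BoundedFormula.listEncode, List.replicate_succ']
    simp

theorem encode_list_map {β : Type} [Encodable β] (l : List β) :
    encode l = encode (l.map encode) := by
  induction l with
  | nil => rfl
  | cons a l ih => simp [encode_list_cons, ih]

/-- Numerical code list of a term. -/
def nl {k : ℕ} (t : grpLang.Term (Empty ⊕ Fin k)) : List ℕ := t.listEncode.map encode

theorem encode_term {k : ℕ} (t : grpLang.Term (Empty ⊕ Fin k)) :
    encode t = encode (nl t) := by
  rw [nl, ← encode_list_map]; rfl

theorem primrec_append_enc {β : Type} [Encodable β] (pre : List β) (post : List β) :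
    ∃ F : ℕ → ℕ, Primrec F ∧ ∀ b : β, encode (pre ++ b :: post) = F (encode b) := by
  induction pre with
  | nil =>
    exact ⟨fun n => Nat.succ (Nat.pair n (encode post)),
      Primrec.succ.comp (Primrec₂.natPair.comp .id (.const _)), fun b => rfl⟩
  | cons a pre ih =>
    obtain ⟨F, h1, h2⟩ := ih
    refine ⟨fun n => Nat.succ (Nat.pair (encode a) (F n)),
      Primrec.succ.comp (Primrec₂.natPair.comp (.const _) h1), fun b => ?_⟩
    rw [List.cons_append, encode_list_cons, h2]

theorem encode_sentence {k : ℕ}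
    (L : List (grpLang.Term (Empty ⊕ Fin k) × grpLang.Term (Empty ⊕ Fin k)))
    (t' : grpLang.Term (Empty ⊕ Fin k)) :
    ∃ F : List ℕ → ℕ, Primrec F ∧ ∀ t, encode ((impl L t t').alls : grpLang.Sentence) = F (nl t) := by
  obtain ⟨pre, hpre⟩ := listEncode_impl L t'
  obtain ⟨F, hF1, hF2⟩ := primrec_append_enc
    (List.replicate k (Sum.inr (Sum.inr 1)) ++ pre) [Sum.inl ⟨k, t'⟩]
  refine ⟨fun l => F (2 * Nat.pair k (encode l)), ?_, fun t => ?_⟩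
  · exact hF1.comp (Primrec.nat_mul.comp (.const 2)
      (Primrec₂.natPair.comp (.const k) Primrec.encode))
  · have h1 : encode ((impl L t t').alls : grpLang.Sentence) =
        encode ((impl L t t').alls.listEncode) := rfl
    rw [h1, listEncode_alls, hpre, ← List.append_assoc, hF2]
    show _ = F (2 * Nat.pair k (encode (nl t)))
    rw [← encode_term]
    rfl

variable {k : ℕ}

/-- Code of the multiplication symbol. -/
def cMul (k : ℕ) : ℕ := encode (Sum.inr ⟨2, ()⟩ : (Empty ⊕ Fin k) ⊕ (Σ i, grpLang.Functions i))

/-- Code of the inversion symbol. -/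
def cInv (k : ℕ) : ℕ := encode (Sum.inr ⟨1, ()⟩ : (Empty ⊕ Fin k) ⊕ (Σ i, grpLang.Functions i))

theorem nl_mul (a b : grpLang.Term (Empty ⊕ Fin k)) : nl (mulT a b) = cMul k :: (nl a ++ nl b) := by
  simp [nl, mulT, Term.listEncode, cMul, List.finRange_succ]

theorem nl_inv (a : grpLang.Term (Empty ⊕ Fin k)) : nl (invT a) = cInv k :: nl a := by
  simp [nl, invT, Term.listEncode, cInv, List.finRange_succ]

/-- The term of a word. -/
def tt {A : Type} (E : Fin 5 → Fin 5 → Option A → grpLang.Term V) : List A → grpLang.Term V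
  | [] => E 1 0 none
  | s :: w => commT (E 1 2 (some s)) (commT (E 2 1 none) (tt E w))

theorem realize_tt {A G : Type} [Group G] (x : V → G)
    (E : Fin 5 → Fin 5 → Option A → grpLang.Term V) (w : List A) :
    (tt E w).realize x = tw (fun i j s => (E i j s).realize x) w := by
  induction w with
  | nil => rfl
  | cons s w ih => rw [tt, realize_commT, realize_commT, ih, tw]

theorem nl_comm (a : grpLang.Term (Empty ⊕ Fin k)) :
    ∃ F : List ℕ → List ℕ, Primrec F ∧ ∀ t, nl (commT a t) = F (nl t) := by
  refine ⟨fun l => cMul k :: ((cMul k :: ((cMul k :: (nl a ++ l)) ++ (cInv k :: nl a))) ++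
    (cInv k :: l)), ?_, fun t => ?_⟩
  · refine Primrec.list_cons.comp (.const _) (Primrec.list_append.comp (Primrec.list_cons.comp
      (.const _) (Primrec.list_append.comp (Primrec.list_cons.comp (.const _)
        (Primrec.list_append.comp (.const _) .id)) (.const _)))
      (Primrec.list_cons.comp (.const _) .id))
  · rw [commT, nl_mul, nl_mul, nl_mul, nl_inv, nl_inv]

theorem nl_tt {A : Type} (E : Fin 5 → Fin 5 → Option A → grpLang.Term (Empty ⊕ Fin k))
    (x y : List A) (a : A) :
    Primrec (fun m : ℕ => nl (tt E (x ++ (List.replicate m a ++ y)))) := by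
  have step : ∀ s : A, ∃ F : List ℕ → List ℕ, Primrec F ∧
      ∀ w, nl (tt E (s :: w)) = F (nl (tt E w)) := by
    intro s
    obtain ⟨F1, h1, h2⟩ := nl_comm (E 1 2 (some s))
    obtain ⟨F2, h3, h4⟩ := nl_comm (E 2 1 none)
    exact ⟨fun l => F1 (F2 l), h1.comp h3, fun w => by rw [tt, h2, h4]⟩
  induction x with
  | nil =>
    obtain ⟨F, h1, h2⟩ := step a
    have : ∀ m, nl (tt E ([] ++ (List.replicate m a ++ y))) = F^[m] (nl (tt E y)) := by
      intro m
      induction m with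
      | zero => rfl
      | succ m ih =>
        rw [Function.iterate_succ_apply', ← ih, List.replicate_succ, List.nil_append,
          List.cons_append, h2, List.nil_append]
    simp only [this]
    exact Primrec.nat_iterate .id (.const _) (h1.comp .snd).to₂
  | cons s x ih =>
    obtain ⟨F, h1, h2⟩ := step s
    simp only [List.cons_append, h2]
    exact h1.comp ih

theorem exists_formulas {A : Type} [Finite A] {R : Set (List A × List A)} (hR : R.Finite)
    (x y v : List A) (a : A) :
    ∃ φ : ℕ → grpLang.Sentence, (∀ m, IsUniversalSentence (φ m)) ∧
      Computable (fun m => encode (φ m)) ∧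
      ∀ m (G : Type) [Group G], G ⊨ φ m ↔ ∀ e : Fin 5 → Fin 5 → Option A → G, Good R e →
        tw e (x ++ (List.replicate m a ++ y)) = tw e v := by
  obtain ⟨k, ⟨ι⟩⟩ := Finite.exists_equiv_fin (Fin 5 × Fin 5 × Option A)
  let E : Fin 5 → Fin 5 → Option A → grpLang.Term (Empty ⊕ Fin k) :=
    fun i j s => Term.var (Sum.inr (ι (i, j, s)))
  let T := grpLang.Term (Empty ⊕ Fin k)
  let r1 : Set (T × T) := {p | ∃ i j k l s t, i ≠ j ∧ k ≠ l ∧ j ≠ k ∧ i ≠ l ∧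
    p = (mulT (E i j s) (E k l t), mulT (E k l t) (E i j s))}
  let r2 : Set (T × T) := {p | ∃ i j k s, i ≠ j ∧ j ≠ k ∧ i ≠ k ∧
    p = (commT (E i j none) (E j k s), E i k s)}
  let r3 : Set (T × T) := {p | ∃ i j k s, i ≠ j ∧ j ≠ k ∧ i ≠ k ∧
    p = (commT (E i j s) (E j k none), E i k s)}
  let r4 : Set (T × T) := (fun lr => (tt E lr.1, tt E lr.2)) '' R
  have f1 : r1.Finite := by
    refine (Set.finite_range (fun q : Fin 5 × Fin 5 × Fin 5 × Fin 5 × Option A × Option A =>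
      (mulT (E q.1 q.2.1 q.2.2.2.2.1) (E q.2.2.1 q.2.2.2.1 q.2.2.2.2.2),
        mulT (E q.2.2.1 q.2.2.2.1 q.2.2.2.2.2) (E q.1 q.2.1 q.2.2.2.2.1)))).subset ?_
    rintro _ ⟨i, j, k, l, s, t, -, -, -, -, rfl⟩
    exact ⟨(i, j, k, l, s, t), rfl⟩
  have f2 : r2.Finite := by
    refine (Set.finite_range (fun q : Fin 5 × Fin 5 × Fin 5 × Option A =>
      (commT (E q.1 q.2.1 none) (E q.2.1 q.2.2.1 q.2.2.2), E q.1 q.2.2.1 q.2.2.2))).subset ?_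
    rintro _ ⟨i, j, k, s, -, -, -, rfl⟩
    exact ⟨(i, j, k, s), rfl⟩
  have f3 : r3.Finite := by
    refine (Set.finite_range (fun q : Fin 5 × Fin 5 × Fin 5 × Option A =>
      (commT (E q.1 q.2.1 q.2.2.2) (E q.2.1 q.2.2.1 none), E q.1 q.2.2.1 q.2.2.2))).subset ?_
    rintro _ ⟨i, j, k, s, -, -, -, rfl⟩
    exact ⟨(i, j, k, s), rfl⟩
  have f4 : r4.Finite := hR.image _
  have f := ((f1.union f2).union f3).union f4
  let L : List (T × T) := f.toFinset.toList
  have hL : ∀ p, p ∈ L ↔ ((p ∈ r1 ∨ p ∈ r2) ∨ p ∈ r3) ∨ p ∈ r4 := by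
    intro p
    simp only [L, Finset.mem_toList, Set.Finite.mem_toFinset, Set.mem_union]
  obtain ⟨F, hF1, hF2⟩ := encode_sentence L (tt E v)
  refine ⟨fun m => (impl L (tt E (x ++ (List.replicate m a ++ y))) (tt E v)).alls,
    fun m => ⟨k, _, impl_isQF _ _ _, rfl⟩, ?_, fun m G _ => ?_⟩
  · simp only [hF2]
    exact (hF1.comp (nl_tt E x y a)).to_comp
  · show G ⊨ ((impl L (tt E (x ++ (List.replicate m a ++ y))) (tt E v)).alls : grpLang.Sentence) ↔ _
    rw [Sentence.Realize, BoundedFormula.realize_alls]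
    simp only [realize_impl, realize_tt]
    have hgood : ∀ z : Fin k → G,
        (∀ p ∈ L, p.1.realize (Sum.elim (default : Empty → G) z) =
          p.2.realize (Sum.elim (default : Empty → G) z)) ↔
        Good R (fun i j s => z (ι (i, j, s))) := by
      intro z
      constructor
      · intro h
        refine ⟨?_, ?_, ?_, ?_⟩
        · intro i j k l s t h1 h2 h3 h4
          exact h _ ((hL _).2 (Or.inl (Or.inl (Or.inl ⟨i, j, k, l, s, t, h1, h2, h3, h4, rfl⟩))))
        · intro i j k s h1 h2 h3
          exact h _ ((hL _).2 (Or.inl (Or.inl (Or.inr ⟨i, j, k, s, h1, h2, h3, rfl⟩))))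
        · intro i j k s h1 h2 h3
          exact h _ ((hL _).2 (Or.inl (Or.inr ⟨i, j, k, s, h1, h2, h3, rfl⟩)))
        · intro lr hlr
          have := h _ ((hL _).2 (Or.inr ⟨lr, hlr, rfl⟩))
          simp only [realize_tt] at this
          exact this
      · rintro h p hp
        rcases (hL _).1 hp with ((⟨i, j, k, l, s, t, h1, h2, h3, h4, rfl⟩ |
          ⟨i, j, k, s, h1, h2, h3, rfl⟩) | ⟨i, j, k, s, h1, h2, h3, rfl⟩) | ⟨lr, hlr, rfl⟩
        · exact h.comm i j k l s t h1 h2 h3 h4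
        · exact h.unl i j k s h1 h2 h3
        · exact h.unr i j k s h1 h2 h3
        · simp only [realize_tt]
          exact h.rule lr hlr
    constructor
    · intro h e he
      have := h (fun n => e (ι.symm n).1 (ι.symm n).2.1 (ι.symm n).2.2)
        ((hgood _).2 (by simpa using he))
      simpa [E] using this
    · intro h z hz
      exact h _ ((hgood z).1 hz)

end Formulas

section Final

theorem undec_aux :
    ¬ ∃ f : ℕ → Bool, Computable f ∧
      ∀ φ : grpLang.Sentence, IsUniversalSentence φ →
        (f (Encodable.encode φ) = true ↔
          ∀ (G : Type) [Group G], Monoid.IsTorsion G → G ⊨ φ) := by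
  rintro ⟨f0, hf0, H⟩
  let U : ℕ →. ℕ := fun m => Nat.Partrec.Code.eval (Denumerable.ofNat Nat.Partrec.Code m) m
  have hU : Partrec U :=
    Nat.Partrec.Code.eval_part.comp (Computable.ofNat _) Computable.id
  let f : ℕ →. ℕ := fun n => (Nat.rfind fun m => Part.some (decide (2 ^ m = n))).bind U
  have hf : Partrec f := by
    refine Partrec.bind (Partrec.rfind ?_) (hU.comp Computable.snd).to₂
    have h2 : Primrec₂ (fun n m : ℕ => decide (2 ^ m = n)) := by
      refine PrimrecRel.decide ?_
      refine PrimrecRel.comp Primrec.eq ?_ Primrec.fst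
      have : Primrec (fun m : ℕ => 2 ^ m) := by
        have h := Primrec.nat_iterate (α := ℕ) (β := ℕ) (f := fun m => m) (g := fun _ => 1)
          (h := fun _ b => 2 * b) .id (.const 1) (Primrec.nat_mul.comp (.const 2) .snd).to₂
        refine h.of_eq fun m => ?_
        induction m with
        | zero => rfl
        | succ m ih => rw [Function.iterate_succ_apply', ih, pow_succ, mul_comm]
      exact this.comp .snd
    exact h2.to_comp.partrec₂
  have hfU : ∀ m b, b ∈ U m → b ∈ f (2 ^ m) := by
    intro m b hb
    refine Part.mem_bind_iff.2 ⟨m, ?_, hb⟩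
    refine Nat.mem_rfind.2 ⟨by simp, fun {n} hn => ?_⟩
    simp [(Nat.pow_lt_pow_right (one_lt_two) hn).ne]
  obtain ⟨A, _, R, x, y, v, a, hR, HR⟩ := exists_rewriting f hf
  obtain ⟨φ, hφ1, hφ2, hφ3⟩ := exists_formulas hR x y v a
  have hg : Computable (fun m => bif f0 (Encodable.encode (φ m)) then 0 else 1 : ℕ → ℕ) :=
    Computable.cond (hf0.comp hφ2) (Computable.const 0) (Computable.const 1)
  obtain ⟨c, hc⟩ := Nat.Partrec.Code.exists_code.1 (Partrec.nat_iff.1 hg)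
  let m := Encodable.encode c
  have hm : U m = Part.some (bif f0 (Encodable.encode (φ m)) then 0 else 1) := by
    simp only [U, m, Denumerable.ofNat_encode, hc]
    rfl
  have Hm := H (φ m) (hφ1 m)
  cases hb : f0 (Encodable.encode (φ m)) with
  | true =>
    have h0 : 0 ∈ U m := by rw [hm, hb]; exact Part.mem_some _
    obtain ⟨C, h1, h2, h3, h4⟩ := (HR m).1 (hfU _ _ h0)
    obtain ⟨G, _, _, e, he, hne⟩ := exists_model h1 h2 h3 h4
    exact hne ((hφ3 m G).1 (Hm.1 hb G isTorsion_of_finite) e he)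
  | false =>
    have h0 : 1 ∈ U m := by rw [hm, hb]; exact Part.mem_some _
    have h1 := (HR m).2 (hfU _ _ h0)
    have : f0 (Encodable.encode (φ m)) = true :=
      Hm.2 fun G _ _ => (hφ3 m G).2 fun e he => tw_rws he h1
    simp [hb] at this

end Final

end TorsionUndec

/-- The universal theory of the class of torsion groups is undecidable: no computable
function decides, for a given universal sentence, whether it holds in every torsion
group. -/
theorem univTheory_torsion_undecidable :
    ¬ ∃ f : ℕ → Bool, Computable f ∧
      ∀ φ : grpLang.Sentence, IsUniversalSentence φ →
        (f (Encodable.encode φ) = true ↔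
          ∀ (G : Type) [Group G], Monoid.IsTorsion G → G ⊨ φ) := by
  exact TorsionUndec.undec_aux
end
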